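/- Let F be a field with |F| ≥ 3, n ≥ 2, and let J ⊆ I with |J| ≥ 3. Then the parabolic subgroup P_J of Sp_{2n}(F) is the universal completion of the amalgam {P_{J−{j}} : j ∈ J}. Precisely: (i) P_J is generated by the union of the subgroups P_{J−{j}}, j ∈ J; and (ii) for every group K and every family of homomorphisms f_j : P_{J−{j}} → K (j ∈ J) such that f_j and f_{j'} agree on the intersection P_{J−{j}} ∩ P_{J−{j'}} for all j, j' ∈ J, there exists a unique group homomorphism Φ : P_J → K restricting to f_j on P_{J−{j}} for every j ∈ J. -/

import Mathlib

open Matrix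

def Smat (F : Type) [Field F] (m : ℕ) : Matrix (Fin m) (Fin m) F :=
  Matrix.of fun i j =>
    if (i : ℕ) % 2 = 0 ∧ (j : ℕ) = (i : ℕ) + 1 then 1
    else if (j : ℕ) % 2 = 0 ∧ (i : ℕ) = (j : ℕ) + 1 then -1 else 0

/-- `V = F^{2n}`. -/
abbrev Vn (F : Type) [Field F] (n : ℕ) := Fin (2*n) → F

/-- The standard symplectic form `s` on `F^{2n}`:
`s(h_{2i−1}, h_{2i}) = 1 = −s(h_{2i}, h_{2i−1})`, all other pairs of basis vectors orthogonal. -/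
def sB (F : Type) [Field F] (n : ℕ) (v w : Vn F n) : F :=
  ∑ i, ∑ j, v i * Smat F (2*n) i j * w j

/-- `Sp_{2n}(F)`: the group of linear automorphisms of `V = F^{2n}` preserving `s`. -/
def SpV (F : Type) [Field F] (n : ℕ) : Subgroup ((Vn F n) ≃ₗ[F] (Vn F n)) where
  carrier := {g | ∀ v w, sB F n (g v) (g w) = sB F n v w}
  one_mem' := by intro v w; rfl
  mul_mem' := by
    intro a b ha hb v w
    have h : ∀ x, (a * b) x = a (b x) := fun x => rfl
    rw [h, h, ha, hb]
  inv_mem' := by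
    intro a ha v w
    have h1 := ha (a⁻¹ v) (a⁻¹ w)
    have h2 : a (a⁻¹ v) = v := by
      have := congrArg (fun (e : (Vn F n) ≃ₗ[F] (Vn F n)) => e v) (mul_inv_cancel a)
      exact this
    have h3 : a (a⁻¹ w) = w := by
      have := congrArg (fun (e : (Vn F n) ≃ₗ[F] (Vn F n)) => e w) (mul_inv_cancel a)
      exact this
    rw [h2, h3] at h1
    exact h1.symm

/-- `C_l = span(h₁, …, h_l)` (0-based: span of the `Pi.single k 1`, `k < l`). -/
def Cl (F : Type) [Field F] (n l : ℕ) : Submodule F (Vn F n) :=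
  Submodule.span F {v | ∃ k : Fin (2*n), (k : ℕ) < l ∧ v = Pi.single k 1}

/-- The subgroup of linear automorphisms stabilizing `C_l` for every `l ∈ T`. -/
def chFix (F : Type) [Field F] (n : ℕ) (T : Set ℕ) : Subgroup ((Vn F n) ≃ₗ[F] (Vn F n)) where
  carrier := {g | ∀ l ∈ T, Submodule.map (g : Vn F n →ₗ[F] Vn F n) (Cl F n l) = Cl F n l}
  one_mem' := by
    intro l _
    have : ((1 : (Vn F n) ≃ₗ[F] (Vn F n)) : Vn F n →ₗ[F] Vn F n) = LinearMap.id := rfl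
    rw [this, Submodule.map_id]
  mul_mem' := by
    intro a b ha hb l hl
    have h : ((a * b : (Vn F n) ≃ₗ[F] (Vn F n)) : Vn F n →ₗ[F] Vn F n) =
        (a : Vn F n →ₗ[F] Vn F n).comp (b : Vn F n →ₗ[F] Vn F n) := rfl
    rw [h, Submodule.map_comp, hb l hl, ha l hl]
  inv_mem' := by
    intro a ha l hl
    have h3 : Submodule.map ((a⁻¹ : (Vn F n) ≃ₗ[F] (Vn F n)) : Vn F n →ₗ[F] Vn F n)
        (Submodule.map (a : Vn F n →ₗ[F] Vn F n) (Cl F n l)) = Cl F n l := by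
      rw [← Submodule.map_comp]
      have h4 : ((a⁻¹ : (Vn F n) ≃ₗ[F] (Vn F n)) : Vn F n →ₗ[F] Vn F n).comp
          (a : Vn F n →ₗ[F] Vn F n) = LinearMap.id :=
        LinearMap.ext fun v =>
          congrArg (fun (e : (Vn F n) ≃ₗ[F] (Vn F n)) => e v) (inv_mul_cancel a)
      rw [h4, Submodule.map_id]
    rw [ha l hl] at h3
    exact h3

/-- The parabolic subgroup `P_J = {g ∈ Sp_{2n}(F) : g C_l = C_l for all l ∈ I − J}`,
where `I = {1, …, 2n−1}`. -/
def Par (F : Type) [Field F] (n : ℕ) (J : Finset ℕ) : Subgroup ((Vn F n) ≃ₗ[F] (Vn F n)) :=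
  SpV F n ⊓ chFix F n {l | l ∈ Finset.Icc 1 (2*n-1) ∧ l ∉ J}

theorem Par_le_SpV (F : Type) [Field F] (n : ℕ) (J : Finset ℕ) : Par F n J ≤ SpV F n :=
  inf_le_left

theorem Par_mono (F : Type) [Field F] (n : ℕ) {J J' : Finset ℕ} (h : J ⊆ J') :
    Par F n J ≤ Par F n J' := by
  refine inf_le_inf_left _ ?_
  intro g hg l hl
  exact hg l ⟨hl.1, fun hmem => hl.2 (h hmem)⟩

/-- The elements `x, y, z` of `G` represent three points of a common `P₃`-object. -/
def IsCoplanarTriple {L : Type*} [Group L] (G P₁ P₃ : Subgroup L) (x y z : L) : Prop :=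
  ∃ g ∈ G, ∃ u ∈ P₃, ∃ v ∈ P₃, ∃ w ∈ P₃,
    (g * u)⁻¹ * x ∈ P₁ ∧ (g * v)⁻¹ * y ∈ P₁ ∧ (g * w)⁻¹ * z ∈ P₁

/-- Conditions on an adjacency relation `A` on the coset space `G / P₁` which make the coset
geometry of `P₁, P₂, P₃` in `G` simply connected. -/
structure TriangleGeometry {L : Type*} [Group L] (G P₁ P₂ P₃ : Subgroup L)
    (A : L → L → Prop) : Prop where
  le₁ : P₁ ≤ G
  le₂ : P₂ ≤ G
  le₃ : P₃ ≤ G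
  smul : ∀ {g x y}, g ∈ G → x ∈ G → y ∈ G → A x y → A (g * x) (g * y)
  symm : ∀ {x y}, A x y → A y x
  right : ∀ {x y p}, x ∈ G → y ∈ G → p ∈ P₁ → A x y → A x (y * p)
  irrefl : ∀ {p}, p ∈ P₁ → ¬ A 1 p
  dichotomy : ∀ {t}, t ∈ P₂ → t ∈ P₁ ∨ A 1 t
  edge : ∀ {g}, g ∈ G → A 1 g → ∃ h ∈ P₁, ∃ t ∈ P₂, (h * t)⁻¹ * g ∈ P₁
  line_unique : ∀ {h t t'}, h ∈ P₁ → t ∈ P₂ → t ∉ P₁ → t' ∈ P₂ → t'⁻¹ * (h * t) ∈ P₁ → h ∈ P₂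
  plane : ∀ {u}, u ∈ P₃ → A 1 u → ∃ h ∈ P₁ ⊓ P₃, ∃ t ∈ P₂ ⊓ P₃, (h * t)⁻¹ * u ∈ P₁
  triangle : ∀ {y z}, y ∈ G → z ∈ G → A 1 y → A 1 z → A y z → IsCoplanarTriple G P₁ P₃ 1 y z ∨
    ∃ w ∈ G, A 1 w ∧ IsCoplanarTriple G P₁ P₃ 1 y w ∧ IsCoplanarTriple G P₁ P₃ 1 z w ∧
      IsCoplanarTriple G P₁ P₃ y z w ∧ A y w ∧ A z w
  diameter : ∀ {g}, g ∈ G → ∃ w ∈ G, A 1 w ∧ A w g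
  path : ∀ {z x y}, z ∈ G → x ∈ G → y ∈ G → A 1 z → A z x → A x y →
    A 1 x ∨ A z y ∨ ∃ w ∈ G, A 1 w ∧ A z w ∧ A x w ∧ A y w

section Lifting

variable {L H : Type*} [Group L] [Group H] {G P₁ P₂ P₃ : Subgroup L} {A : L → L → Prop}

theorem IsCoplanarTriple.smul {g x y z : L} (hg : g ∈ G) (h : IsCoplanarTriple G P₁ P₃ x y z) :
    IsCoplanarTriple G P₁ P₃ (g * x) (g * y) (g * z) := by
  obtain ⟨k, hk, u, hu, v, hv, w, hw, h1, h2, h3⟩ := h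
  refine ⟨g * k, mul_mem hg hk, u, hu, v, hv, w, hw, ?_, ?_, ?_⟩
  · convert h1 using 1; group
  · convert h2 using 1; group
  · convert h3 using 1; group

theorem IsCoplanarTriple.rotate {x y z : L} (h : IsCoplanarTriple G P₁ P₃ x y z) :
    IsCoplanarTriple G P₁ P₃ y z x := by
  obtain ⟨k, hk, u, hu, v, hv, w, hw, h1, h2, h3⟩ := h
  exact ⟨k, hk, v, hv, w, hw, u, hu, h2, h3, h1⟩

theorem IsCoplanarTriple.swap {x y z : L} (h : IsCoplanarTriple G P₁ P₃ x y z) :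
    IsCoplanarTriple G P₁ P₃ y x z := by
  obtain ⟨k, hk, u, hu, v, hv, w, hw, h1, h2, h3⟩ := h
  exact ⟨k, hk, v, hv, u, hu, w, hw, h2, h1, h3⟩

/-- The adjacency relation lifted along a homomorphism `π`. -/
def LiftAdj (π : H →* L) (Γ₁ Γ₂ : Subgroup H) (A : L → L → Prop) (x y : H) : Prop :=
  A (π x) (π y) ∧ ∃ h ∈ Γ₁, ∃ t ∈ Γ₂, (h * t)⁻¹ * (x⁻¹ * y) ∈ Γ₁

/-- `π` identifies `Γᵢ` with `Pᵢ`, compatibly on intersections. -/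
structure AmalgamLift (π : H →* L) (Γ₁ Γ₂ Γ₃ : Subgroup H) (P₁ P₂ P₃ : Subgroup L) : Prop where
  map₁ : Γ₁.map π = P₁
  map₂ : Γ₂.map π = P₂
  map₃ : Γ₃.map π = P₃
  inj : ∀ x ∈ (Γ₁ : Set H) ∪ Γ₂ ∪ Γ₃, ∀ y ∈ (Γ₁ : Set H) ∪ Γ₂ ∪ Γ₃, π x = π y → x = y

variable {π : H →* L} {Γ₁ Γ₂ Γ₃ : Subgroup H}

namespace AmalgamLift

variable (hl : AmalgamLift π Γ₁ Γ₂ Γ₃ P₁ P₂ P₃)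
include hl

theorem mem₁ {x : H} (hx : x ∈ (Γ₁ : Set H) ∪ Γ₂ ∪ Γ₃) (h : π x ∈ P₁) : x ∈ Γ₁ := by
  rw [← hl.map₁] at h
  obtain ⟨y, hy, e⟩ := h
  rwa [hl.inj x hx y (Or.inl (Or.inl hy)) e.symm]

theorem mem₂ {x : H} (hx : x ∈ (Γ₁ : Set H) ∪ Γ₂ ∪ Γ₃) (h : π x ∈ P₂) : x ∈ Γ₂ := by
  rw [← hl.map₂] at h
  obtain ⟨y, hy, e⟩ := h
  rwa [hl.inj x hx y (Or.inl (Or.inr hy)) e.symm]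

theorem mem₃ {x : H} (hx : x ∈ (Γ₁ : Set H) ∪ Γ₂ ∪ Γ₃) (h : π x ∈ P₃) : x ∈ Γ₃ := by
  rw [← hl.map₃] at h
  obtain ⟨y, hy, e⟩ := h
  rwa [hl.inj x hx y (Or.inr hy) e.symm]

theorem map_mem₁ {x : H} (hx : x ∈ Γ₁) : π x ∈ P₁ := hl.map₁ ▸ Subgroup.mem_map_of_mem π hx
theorem map_mem₂ {x : H} (hx : x ∈ Γ₂) : π x ∈ P₂ := hl.map₂ ▸ Subgroup.mem_map_of_mem π hx
theorem map_mem₃ {x : H} (hx : x ∈ Γ₃) : π x ∈ P₃ := hl.map₃ ▸ Subgroup.mem_map_of_mem π hx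

end AmalgamLift

theorem LiftAdj.symm (hg : TriangleGeometry G P₁ P₂ P₃ A) {x y : H}
    (h : LiftAdj π Γ₁ Γ₂ A x y) : LiftAdj π Γ₁ Γ₂ A y x := by
  obtain ⟨hA, a, ha, t, ht, hp⟩ := h
  refine ⟨hg.symm hA, _, inv_mem hp, t⁻¹, inv_mem ht, ?_⟩
  convert inv_mem ha using 1
  group

theorem LiftAdj.right (hg : TriangleGeometry G P₁ P₂ P₃ A)
    (hl : AmalgamLift π Γ₁ Γ₂ Γ₃ P₁ P₂ P₃) {x y p : H} (hx : π x ∈ G) (hy : π y ∈ G)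
    (hp : p ∈ Γ₁) (h : LiftAdj π Γ₁ Γ₂ A x y) : LiftAdj π Γ₁ Γ₂ A x (y * p) := by
  obtain ⟨hA, a, ha, t, ht, hq⟩ := h
  refine ⟨?_, a, ha, t, ht, ?_⟩
  · rw [map_mul]; exact hg.right hx hy (hl.map_mem₁ hp) hA
  · convert mul_mem hq hp using 1; group

theorem LiftAdj.unique (hg : TriangleGeometry G P₁ P₂ P₃ A)
    (hl : AmalgamLift π Γ₁ Γ₂ Γ₃ P₁ P₂ P₃) {x y y' : H} (hx : π x ∈ G) (hy' : π y' ∈ G)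
    (h : LiftAdj π Γ₁ Γ₂ A x y) (h' : LiftAdj π Γ₁ Γ₂ A x y')
    (hyy : (π y)⁻¹ * π y' ∈ P₁) : y⁻¹ * y' ∈ Γ₁ := by
  obtain ⟨-, a, ha, t, ht, hp⟩ := h
  obtain ⟨hA, k, hk, r, hr, hq⟩ := h'
  obtain ⟨p, hpdef⟩ : ∃ p, p = (a * t)⁻¹ * (x⁻¹ * y) := ⟨_, rfl⟩
  obtain ⟨q, hqdef⟩ : ∃ q, q = (k * r)⁻¹ * (x⁻¹ * y') := ⟨_, rfl⟩
  rw [← hpdef] at hp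
  rw [← hqdef] at hq
  have ey : y = x * (a * t * p) := by rw [hpdef]; group
  have ey' : y' = x * (k * r * q) := by rw [hqdef]; group
  have hr1 : π r ∉ P₁ := by
    intro hr1
    have hA' := hg.smul (inv_mem hx) hx hy' hA
    rw [ey', map_mul, inv_mul_cancel, inv_mul_cancel_left] at hA'
    refine hg.irrefl ?_ hA'
    rw [map_mul, map_mul]
    exact mul_mem (mul_mem (hl.map_mem₁ hk) hr1) (hl.map_mem₁ hq)
  have e1 : t⁻¹ * (a⁻¹ * k * r) = p * (y⁻¹ * y') * q⁻¹ := by rw [ey, ey']; group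
  have h1 : π (t⁻¹ * (a⁻¹ * k * r)) ∈ P₁ := by
    rw [e1, map_mul, map_mul, map_mul, map_inv]
    exact mul_mem (mul_mem (hl.map_mem₁ hp) hyy) (hl.map_mem₁ (inv_mem hq))
  have hak : a⁻¹ * k ∈ Γ₁ := mul_mem (inv_mem ha) hk
  have h2 : a⁻¹ * k ∈ Γ₂ := by
    refine hl.mem₂ (Or.inl (Or.inl hak)) (hg.line_unique (hl.map_mem₁ hak) (hl.map_mem₂ hr) hr1
      (hl.map_mem₂ ht) ?_)
    rwa [← map_mul, ← map_inv, ← map_mul]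
  have h3 : t⁻¹ * (a⁻¹ * k * r) ∈ Γ₁ :=
    hl.mem₁ (Or.inl (Or.inr (mul_mem (inv_mem ht) (mul_mem h2 hr)))) h1
  have e2 : y⁻¹ * y' = p⁻¹ * (t⁻¹ * (a⁻¹ * k * r)) * q := by rw [e1]; group
  rw [e2]
  exact mul_mem (mul_mem (inv_mem hp) h3) hq

theorem LiftAdj.exists_lift (hg : TriangleGeometry G P₁ P₂ P₃ A)
    (hl : AmalgamLift π Γ₁ Γ₂ Γ₃ P₁ P₂ P₃) {x : H} {g : L} (hx : π x ∈ G) (hgG : g ∈ G)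
    (h : A (π x) g) : ∃ y, π y = g ∧ LiftAdj π Γ₁ Γ₂ A x y := by
  have h' := hg.smul (inv_mem hx) hx hgG h
  rw [inv_mul_cancel] at h'
  obtain ⟨a, ha, t, ht, hp⟩ := hg.edge (mul_mem (inv_mem hx) hgG) h'
  set p := (a * t)⁻¹ * ((π x)⁻¹ * g) with hpdef
  have eg : g = π x * (a * t * p) := by rw [hpdef]; group
  rw [← hl.map₁] at ha hp
  rw [← hl.map₂] at ht
  obtain ⟨a', ha', ea⟩ := ha
  obtain ⟨p', hp', ep⟩ := hp
  obtain ⟨t', ht', et⟩ := ht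
  have e : π (x * (a' * t' * p')) = g := by rw [eg, map_mul, map_mul, map_mul, ea, ep, et]
  refine ⟨x * (a' * t' * p'), e, by rw [e]; exact h, a', ha', t', ht', ?_⟩
  have e' : (a' * t')⁻¹ * (x⁻¹ * (x * (a' * t' * p'))) = p' := by group
  rw [e']
  exact hp'

theorem liftAdj_of_plane (hg : TriangleGeometry G P₁ P₂ P₃ A)
    (hl : AmalgamLift π Γ₁ Γ₂ Γ₃ P₁ P₂ P₃) {x u v : H} (hx : π x ∈ G) (hu : u ∈ Γ₃)
    (hv : v ∈ Γ₃) (h : A (π (x * u)) (π (x * v))) :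
    LiftAdj π Γ₁ Γ₂ A (x * u) (x * v) := by
  refine ⟨h, ?_⟩
  have huG := hg.le₃ (hl.map_mem₃ hu)
  have hvG := hg.le₃ (hl.map_mem₃ hv)
  have h' := hg.smul (inv_mem (mul_mem hx huG)) (by rw [map_mul]; exact mul_mem hx huG)
    (by rw [map_mul]; exact mul_mem hx hvG) h
  rw [← map_mul, ← map_inv, ← map_mul, inv_mul_cancel, map_one, ← map_mul] at h'
  have e : (x * u)⁻¹ * (x * v) = u⁻¹ * v := by group
  rw [e] at h' ⊢
  have huv : u⁻¹ * v ∈ Γ₃ := mul_mem (inv_mem hu) hv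
  obtain ⟨a, ⟨ha1, ha3⟩, t, ⟨ht2, ht3⟩, hp⟩ := hg.plane (hl.map_mem₃ huv) h'
  rw [SetLike.mem_coe, ← hl.map₁] at ha1
  rw [SetLike.mem_coe, ← hl.map₂] at ht2
  obtain ⟨a', ha', rfl⟩ := ha1
  obtain ⟨t', ht', rfl⟩ := ht2
  have ha3' := hl.mem₃ (Or.inl (Or.inl ha')) ha3
  have ht3' := hl.mem₃ (Or.inl (Or.inr ht')) ht3
  refine ⟨a', ha', t', ht', hl.mem₁ (Or.inr (mul_mem (inv_mem (mul_mem ha3' ht3')) huv)) ?_⟩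
  rwa [map_mul, map_inv, map_mul]

theorem LiftAdj.trans_of_coplanar (hg : TriangleGeometry G P₁ P₂ P₃ A)
    (hl : AmalgamLift π Γ₁ Γ₂ Γ₃ P₁ P₂ P₃) {x y z : H} (hx : π x ∈ G) (hy : π y ∈ G)
    (hz : π z ∈ G) (hc : IsCoplanarTriple G P₁ P₃ (π x) (π y) (π z)) (hxy : LiftAdj π Γ₁ Γ₂ A x y)
    (hyz : LiftAdj π Γ₁ Γ₂ A y z) (hA : A (π x) (π z)) : LiftAdj π Γ₁ Γ₂ A x z := by
  obtain ⟨g, hgG, u, hu, v, hv, w, hw, h1, h2, h3⟩ := hc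
  rw [← hl.map₃] at hu hv hw
  obtain ⟨u', hu', rfl⟩ := hu
  obtain ⟨v', hv', rfl⟩ := hv
  obtain ⟨w', hw', rfl⟩ := hw
  have h1' := h1
  rw [← hl.map₁] at h1
  obtain ⟨p, hp, ep⟩ := h1
  have huG := hg.le₃ (hl.map_mem₃ hu')
  have hvG := hg.le₃ (hl.map_mem₃ hv')
  have hwG := hg.le₃ (hl.map_mem₃ hw')
  set c := x * p⁻¹ * u'⁻¹ with hc
  have ec : π c = g := by
    rw [hc, map_mul, map_mul, map_inv, map_inv, ep]; group
  have ex : x = c * u' * p := by rw [hc]; group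
  have hcG : π c ∈ G := ec ▸ hgG
  have mem {k : H} (hk : π k ∈ G) : π (c * k) ∈ G := by rw [map_mul]; exact mul_mem hcG hk
  have move {k l : H} (hk : π k ∈ G) (hl' : π l ∈ G) (h : (g * π k)⁻¹ * π l ∈ P₁) {m : H}
      (hm : π m ∈ G) (hA : A (π m) (π l)) : A (π m) (π (c * k)) := by
    have := hg.right hm hl' (inv_mem h) hA
    convert this using 1
    rw [map_mul, ec]; group
  have hxu : A (π y) (π (c * u')) := move huG hx h1' hy (hg.symm hxy.1)
  have huv : A (π (c * u')) (π (c * v')) :=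
    move hvG hy h2 (mem huG) (hg.symm hxu)
  have key (k l : H) (hkG : π k ∈ G) (hlG : π l ∈ G) (h : (g * π k)⁻¹ * π l ∈ P₁) (m : H)
      (hm : π m ∈ G) (h1 : LiftAdj π Γ₁ Γ₂ A m l) (h2 : LiftAdj π Γ₁ Γ₂ A m (c * k)) :
      (c * k)⁻¹ * l ∈ Γ₁ := by
    refine LiftAdj.unique hg hl hm hlG h2 h1 ?_
    rw [map_mul, ec]; exact h
  have Luv := liftAdj_of_plane hg hl hcG hu' hv' huv
  have Lvu : LiftAdj π Γ₁ Γ₂ A (c * v') x := by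
    rw [ex]; exact (Luv.symm hg).right hg hl (mem hvG) (mem huG) hp
  have My := key v' y hvG hy h2 x hx hxy (Lvu.symm hg)
  have hvw : A (π (c * v')) (π (c * w')) :=
    move hwG hz h3 (mem hvG) (hg.symm (move hvG hy h2 hz (hg.symm hyz.1)))
  have Lvw := liftAdj_of_plane hg hl hcG hv' hw' hvw
  have Lwy : LiftAdj π Γ₁ Γ₂ A (c * w') y := by
    have := (Lvw.symm hg).right hg hl (mem hwG) (mem hvG) My
    rwa [mul_inv_cancel_left] at this
  have Mz := key w' z hwG hz h3 y hy hyz (Lwy.symm hg)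
  have huw : A (π (c * u')) (π (c * w')) :=
    move hwG hz h3 (mem huG) (hg.symm (move huG hx h1' hz (hg.symm hA)))
  have Luw := liftAdj_of_plane hg hl hcG hu' hw' huw
  have Luz : LiftAdj π Γ₁ Γ₂ A (c * u') z := by
    have := Luw.right hg hl (mem huG) (mem hwG) Mz
    rwa [mul_inv_cancel_left] at this
  have := ((Luz.symm hg).right hg hl hz (mem huG) hp).symm hg
  rwa [← ex] at this

theorem LiftAdj.trans (hg : TriangleGeometry G P₁ P₂ P₃ A)
    (hl : AmalgamLift π Γ₁ Γ₂ Γ₃ P₁ P₂ P₃) {x y z : H} (hx : π x ∈ G) (hy : π y ∈ G)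
    (hz : π z ∈ G) (hxy : LiftAdj π Γ₁ Γ₂ A x y) (hyz : LiftAdj π Γ₁ Γ₂ A y z)
    (hA : A (π x) (π z)) : LiftAdj π Γ₁ Γ₂ A x z := by
  have hx' := inv_mem hx
  have cancel (k : L) : π x * ((π x)⁻¹ * k) = k := by group
  have tr {k l : L} (hk : k ∈ G) (hl' : l ∈ G) (h : A k l) :
      A ((π x)⁻¹ * k) ((π x)⁻¹ * l) := hg.smul hx' hk hl' h
  have a1 := tr hx hy hxy.1
  have a2 := tr hx hz hA
  have a3 := tr hy hz hyz.1
  rw [inv_mul_cancel] at a1 a2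
  rcases hg.triangle (mul_mem hx' hy) (mul_mem hx' hz) a1 a2 a3 with
    h | ⟨w, hw, w1, c1, c2, c3, w2, w3⟩
  · have := h.smul hx
    rw [mul_one, cancel, cancel] at this
    exact LiftAdj.trans_of_coplanar hg hl hx hy hz this hxy hyz hA
  · have w1 := hg.smul hx (one_mem G) hw w1
    have w2 := hg.smul hx (mul_mem hx' hy) hw w2
    have w3 := hg.smul hx (mul_mem hx' hz) hw w3
    have c1 := c1.smul hx
    have c2 := c2.smul hx
    have c3 := c3.smul hx
    rw [mul_one] at w1 c1 c2
    rw [cancel] at w2 w3 c1 c2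
    rw [cancel, cancel] at c3
    obtain ⟨v, ev, hv⟩ := LiftAdj.exists_lift hg hl hx (mul_mem hx hw) w1
    rw [← ev] at w1 w2 w3 c1 c2 c3
    have hvG : π v ∈ G := ev ▸ mul_mem hx hw
    have s1 := LiftAdj.trans_of_coplanar hg hl hvG hx hy c1.rotate.rotate
      (hv.symm hg) hxy (hg.symm w2)
    have s2 := LiftAdj.trans_of_coplanar hg hl hvG hy hz c3.rotate.rotate s1 hyz (hg.symm w3)
    exact LiftAdj.trans_of_coplanar hg hl hx hvG hz c2.rotate.rotate.swap hv s2 hA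

/-- A lift of the amalgam `P₁, P₂, P₃` of a simply connected geometry to a group generated by
`Γ₁` and `Γ₂` is faithful. -/
theorem TriangleGeometry.eq_one_of_map_eq_one (hg : TriangleGeometry G P₁ P₂ P₃ A)
    (hl : AmalgamLift π Γ₁ Γ₂ Γ₃ P₁ P₂ P₃) {x : H}
    (hx : x ∈ Γ₁ ⊔ Γ₂) (h1 : π x = 1) : x = 1 := by
  have hG {y : H} (hy : y ∈ Γ₁ ⊔ Γ₂) : π y ∈ G := by
    have : (Γ₁ ⊔ Γ₂).map π ≤ G := by
      rw [Subgroup.map_sup, hl.map₁, hl.map₂]; exact sup_le hg.le₁ hg.le₂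
    exact this (Subgroup.mem_map_of_mem π hy)
  have one : π (1 : H) ∈ G := by rw [map_one]; exact one_mem G
  let D (x : H) : Prop := ∃ z, π z ∈ G ∧ LiftAdj π Γ₁ Γ₂ A 1 z ∧ LiftAdj π Γ₁ Γ₂ A z x
  have step {x y : H} (hx : π x ∈ G) (hy : π y ∈ G) (hD : D x) (h : LiftAdj π Γ₁ Γ₂ A x y) :
      D y := by
    obtain ⟨z, hz, h1, h2⟩ := hD
    have a1 := h1.1
    rw [map_one] at a1
    rcases hg.path hz hx hy a1 h2.1 h.1 with k | k | ⟨w, hw, w1, wz, wx, wy⟩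
    · rw [← map_one π] at k
      exact ⟨x, hx, LiftAdj.trans hg hl one hz hx h1 h2 k, h⟩
    · exact ⟨z, hz, h1, LiftAdj.trans hg hl hz hx hy h2 h k⟩
    · rw [← map_one π] at w1
      obtain ⟨v, rfl, hv⟩ := LiftAdj.exists_lift hg hl one hw w1
      have s1 := LiftAdj.trans hg hl hw one hz (hv.symm hg) h1 (hg.symm wz)
      have s2 := LiftAdj.trans hg hl hw hz hx s1 h2 (hg.symm wx)
      exact ⟨v, hw, hv, LiftAdj.trans hg hl hw hx hy s2 h (hg.symm wy)⟩
  have main : D x := by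
    clear h1
    rw [Subgroup.sup_eq_closure] at hx
    have stepGen {x t : H} (hx : π x ∈ G) (ht : t ∈ Γ₁ ∨ t ∈ Γ₂) (hD : D x) : D (x * t) := by
      rcases ht with ht | ht
      · obtain ⟨z, hz, h1, h2⟩ := hD
        exact ⟨z, hz, h1, h2.right hg hl hz hx ht⟩
      · rcases hg.dichotomy (hl.map_mem₂ ht) with h | h
        · obtain ⟨z, hz, h1, h2⟩ := hD
          exact ⟨z, hz, h1, h2.right hg hl hz hx (hl.mem₁ (Or.inl (Or.inr ht)) h)⟩
        · have htG := hg.le₂ (hl.map_mem₂ ht)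
          refine step hx (by rw [map_mul]; exact mul_mem hx htG) hD ⟨?_, 1, one_mem _, t, ht, ?_⟩
          · have := hg.smul hx (one_mem G) htG h
            rwa [mul_one, ← map_mul] at this
          · convert one_mem Γ₁ using 1
            group
    induction hx using Subgroup.closure_induction_right with
    | one =>
      obtain ⟨w, hw, h, -⟩ := hg.diameter (one_mem G)
      rw [← map_one π] at h
      obtain ⟨z, rfl, hz⟩ := LiftAdj.exists_lift hg hl one hw h
      exact ⟨z, hw, hz, hz.symm hg⟩
    | mul_right x hx t ht ih =>
      rw [← Subgroup.sup_eq_closure] at hx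
      exact stepGen (hG hx) ht ih
    | mul_inv_cancel x hx t ht ih =>
      rw [← Subgroup.sup_eq_closure] at hx
      exact stepGen (hG hx) (ht.imp inv_mem inv_mem) ih
  obtain ⟨z, hz, hz1, hz2⟩ := main
  have := LiftAdj.unique hg hl hz (hG hx) (hz1.symm hg) hz2 (by rw [h1, map_one]; simp)
  rw [inv_one, one_mul] at this
  exact hl.inj x (Or.inl (Or.inl this)) 1 (Or.inl (Or.inl (one_mem _))) (by rw [h1, map_one])

/-- A lift of the amalgam `P₁, P₂, P₃` is faithful if `P₂ ⊓ P₃` is transitive modulo `P₁`. -/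
theorem AmalgamLift.eq_one_of_transitive (hl : AmalgamLift π Γ₁ Γ₂ Γ₃ P₁ P₂ P₃)
    (htr : ∀ g ∈ P₂ ⊔ P₃, ∃ t ∈ P₂ ⊓ P₃, t⁻¹ * g ∈ P₁) {x : H}
    (hx : x ∈ Γ₂ ⊔ Γ₃) (h1 : π x = 1) : x = 1 := by
  have main : ∃ m ∈ Γ₂ ⊓ Γ₃, m⁻¹ * x ∈ Γ₁ := by
    clear h1
    rw [Subgroup.sup_eq_closure] at hx
    have step {x y : H} (hy : y ∈ Γ₂ ∨ y ∈ Γ₃) (h : ∃ m ∈ Γ₂ ⊓ Γ₃, m⁻¹ * x ∈ Γ₁) :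
        ∃ m ∈ Γ₂ ⊓ Γ₃, m⁻¹ * (y * x) ∈ Γ₁ := by
      obtain ⟨m, hm, hmx⟩ := h
      have hym : y * m ∈ Γ₂ ∨ y * m ∈ Γ₃ :=
        hy.imp (fun h => mul_mem h hm.1) (fun h => mul_mem h hm.2)
      have hym' : π (y * m) ∈ P₂ ⊔ P₃ := hym.elim
        (fun h => Subgroup.mem_sup_left (hl.map_mem₂ h))
        (fun h => Subgroup.mem_sup_right (hl.map_mem₃ h))
      obtain ⟨t, ⟨ht2, ht3⟩, htp⟩ := htr _ hym'
      rw [SetLike.mem_coe, ← hl.map₂] at ht2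
      obtain ⟨s, hs, rfl⟩ := ht2
      have hs3 := hl.mem₃ (Or.inl (Or.inr hs)) ht3
      have hsU : s⁻¹ * (y * m) ∈ (Γ₁ : Set H) ∪ Γ₂ ∪ Γ₃ := hym.elim
        (fun h => Or.inl (Or.inr (mul_mem (inv_mem hs) h)))
        (fun h => Or.inr (mul_mem (inv_mem hs3) h))
      refine ⟨s, ⟨hs, hs3⟩, ?_⟩
      have e : s⁻¹ * (y * x) = s⁻¹ * (y * m) * (m⁻¹ * x) := by group
      rw [e]
      exact mul_mem (hl.mem₁ hsU (by rwa [map_mul, map_inv])) hmx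
    induction hx using Subgroup.closure_induction_left with
    | one => exact ⟨1, one_mem _, by simp⟩
    | mul_left y hy x hx ih => exact step hy ih
    | inv_mul_cancel y hy x hx ih => exact step (hy.imp inv_mem inv_mem) ih
  obtain ⟨m, hm, hmx⟩ := main
  have hm1 : m ∈ Γ₁ := by
    refine hl.mem₁ (Or.inl (Or.inr hm.1)) ?_
    have := hl.map_mem₁ hmx
    rw [map_mul, h1, mul_one, map_inv] at this
    exact inv_mem_iff.mp this
  have hx1 : x ∈ Γ₁ := by
    have := mul_mem hm1 hmx
    rwa [mul_inv_cancel_left] at this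
  exact hl.inj x (Or.inl (Or.inl hx1)) 1 (Or.inl (Or.inl (one_mem _))) (by rw [h1, map_one])

end Lifting

/-- Two subgroups generate if the associated coset graph has diameter at most two. -/
theorem le_sup_of_diameter {L : Type*} [Group L] {G P₁ P₂ : Subgroup L} {A : L → L → Prop}
    (smul : ∀ {g x y}, g ∈ G → x ∈ G → y ∈ G → A x y → A (g * x) (g * y))
    (edge : ∀ {g}, g ∈ G → A 1 g → ∃ h ∈ P₁, ∃ t ∈ P₂, (h * t)⁻¹ * g ∈ P₁)
    (diameter : ∀ {g}, g ∈ G → ∃ w ∈ G, A 1 w ∧ A w g) : G ≤ P₁ ⊔ P₂ := by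
  have key {g : L} (hg : g ∈ G) (h : A 1 g) : g ∈ P₁ ⊔ P₂ := by
    obtain ⟨a, ha, t, ht, hp⟩ := edge hg h
    have e : g = a * t * ((a * t)⁻¹ * g) := by group
    rw [e]
    exact mul_mem (mul_mem (Subgroup.mem_sup_left ha) (Subgroup.mem_sup_right ht))
      (Subgroup.mem_sup_left hp)
  intro g hg
  obtain ⟨w, hw, h1, h2⟩ := diameter hg
  have h3 := smul (inv_mem hw) hw hg h2
  rw [inv_mul_cancel] at h3
  have := mul_mem (key hw h1) (key (mul_mem (inv_mem hw) hg) h3)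
  rwa [mul_inv_cancel_left] at this

section Symplectic

variable {F : Type} [Field F] {n : ℕ}

theorem sB_eq_toBilin' (v w : Vn F n) : sB F n v w = Matrix.toBilin' (Smat F (2 * n)) v w :=
  (Matrix.toBilin'_apply _ v w).symm

@[simp] theorem sB_add_left (u v w : Vn F n) : sB F n (u + v) w = sB F n u w + sB F n v w := by
  simp [sB_eq_toBilin']

@[simp] theorem sB_add_right (u v w : Vn F n) : sB F n u (v + w) = sB F n u v + sB F n u w := by
  simp [sB_eq_toBilin']

@[simp] theorem sB_sub_left (u v w : Vn F n) : sB F n (u - v) w = sB F n u w - sB F n v w := by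
  simp [sB_eq_toBilin']

@[simp] theorem sB_sub_right (u v w : Vn F n) : sB F n u (v - w) = sB F n u v - sB F n u w := by
  simp [sB_eq_toBilin']

@[simp] theorem sB_smul_left (c : F) (v w : Vn F n) : sB F n (c • v) w = c * sB F n v w := by
  simp [sB_eq_toBilin']

@[simp] theorem sB_smul_right (c : F) (v w : Vn F n) : sB F n v (c • w) = c * sB F n v w := by
  simp [sB_eq_toBilin']

@[simp] theorem sB_zero_left (w : Vn F n) : sB F n 0 w = 0 := by simp [sB_eq_toBilin']

@[simp] theorem sB_zero_right (w : Vn F n) : sB F n w 0 = 0 := by simp [sB_eq_toBilin']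

theorem Smat_swap (m : ℕ) (i j : Fin m) : Smat F m j i = -Smat F m i j := by
  simp only [Smat, Matrix.of_apply]
  split_ifs <;> first | omega | simp

theorem sB_swap (v w : Vn F n) : sB F n w v = -sB F n v w := by
  unfold sB
  rw [Finset.sum_comm, ← Finset.sum_neg_distrib]
  refine Finset.sum_congr rfl fun i _ => ?_
  rw [← Finset.sum_neg_distrib]
  refine Finset.sum_congr rfl fun j _ => ?_
  rw [Smat_swap]; ring

theorem sB_single_left (i : Fin (2 * n)) (c : F) (v : Vn F n) :
    sB F n (Pi.single i c) v = c * ∑ j, Smat F (2 * n) i j * v j := by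
  unfold sB
  rw [Finset.sum_eq_single i]
  · simp [Finset.mul_sum, mul_assoc]
  · intro b _ hb; simp [hb]
  · simp

@[simp] theorem sB_self (v : Vn F n) : sB F n v v = 0 := by
  rw [← Finset.univ_sum_single v]
  induction (Finset.univ : Finset (Fin (2 * n))) using Finset.induction_on with
  | empty => simp
  | insert i t hi ih =>
    have h : sB F n (Pi.single i (v i)) (Pi.single i (v i)) = 0 := by
      rw [sB_single_left, Finset.sum_eq_single i]
      · simp [Smat]
      · intro b _ hb; simp [hb]
      · simp
    rw [Finset.sum_insert hi, sB_add_left, sB_add_right, sB_add_right, ih, h,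
      sB_swap (∑ x ∈ t, _)]
    ring

/-- The standard basis vector with index `k` (counted from `0`), and `0` if `2 * n ≤ k`. -/
def eb (F : Type) [Field F] (n k : ℕ) : Vn F n := fun i => if (i : ℕ) = k then 1 else 0

theorem eb_eq_single {k : ℕ} (hk : k < 2 * n) : eb F n k = Pi.single ⟨k, hk⟩ 1 := by
  ext i
  simp [eb, Pi.single_apply, Fin.ext_iff]

theorem sB_eb_even {k : ℕ} (hk : Even k) (h : k + 1 < 2 * n) (v : Vn F n) :
    sB F n (eb F n k) v = v ⟨k + 1, h⟩ := by
  rw [eb_eq_single (by omega), sB_single_left, Finset.sum_eq_single ⟨k + 1, h⟩]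
  · simp [Smat, Nat.even_iff.mp hk]
  · intro b _ hb
    have : (b : ℕ) ≠ k + 1 := fun h => hb (Fin.ext h)
    have := Nat.even_iff.mp hk
    simp only [Smat, Matrix.of_apply]
    split_ifs <;> first | omega | simp
  · simp

theorem sB_eb_odd {k : ℕ} (hk : Even k) (h : k + 1 < 2 * n) (v : Vn F n) :
    sB F n (eb F n (k + 1)) v = -v ⟨k, by omega⟩ := by
  rw [eb_eq_single h, sB_single_left, Finset.sum_eq_single ⟨k, by omega⟩]
  · have := Nat.even_iff.mp hk
    simp only [Smat, Matrix.of_apply]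
    split_ifs <;> first | omega | simp_all
  · intro b _ hb
    have : (b : ℕ) ≠ k := fun h => hb (Fin.ext h)
    have := Nat.even_iff.mp hk
    simp only [Smat, Matrix.of_apply]
    split_ifs <;> first | omega | simp
  · simp

theorem mem_Cl {l : ℕ} {v : Vn F n} : v ∈ Cl F n l ↔ ∀ k : Fin (2 * n), l ≤ k → v k = 0 := by
  constructor
  · intro h
    induction h using Submodule.span_induction with
    | mem x hx =>
      obtain ⟨k, hk, rfl⟩ := hx
      intro j hj
      have : j ≠ k := by rintro rfl; omega
      simp [this]
    | zero => simp
    | add x y _ _ hx hy => intro k hk; simp [hx k hk, hy k hk]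
    | smul a x _ hx => intro k hk; simp [hx k hk]
  · intro h
    rw [← Finset.univ_sum_single v]
    refine Submodule.sum_mem _ fun k _ => ?_
    by_cases hk : (k : ℕ) < l
    · have : Pi.single k (v k) = v k • (Pi.single k 1 : Vn F n) := by
        rw [← Pi.single_smul]; simp
      rw [this]
      exact Submodule.smul_mem _ _ (Submodule.subset_span ⟨k, hk, rfl⟩)
    · rw [h k (by omega), Pi.single_zero]
      exact Submodule.zero_mem _

theorem eb_mem_Cl {k l : ℕ} (h : k < l) : eb F n k ∈ Cl F n l := by
  rw [mem_Cl]
  intro i hi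
  simp only [eb]
  rw [if_neg (by omega)]

theorem Cl_mono {k l : ℕ} (h : k ≤ l) : Cl F n k ≤ Cl F n l := fun _ hv =>
  mem_Cl.mpr fun i hi => mem_Cl.mp hv i (h.trans hi)

theorem exists_of_mem_Cl_succ {l : ℕ} {v : Vn F n} (hv : v ∈ Cl F n (l + 1)) :
    ∃ c : F, v - c • eb F n l ∈ Cl F n l := by
  by_cases hl : l < 2 * n
  · refine ⟨v ⟨l, hl⟩, mem_Cl.mpr fun k hk => ?_⟩
    rcases hk.eq_or_lt with rfl | hk
    · simp [eb]
    · have h1 := mem_Cl.mp hv k hk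
      simp [eb, h1, hk.ne']
  · exact ⟨0, mem_Cl.mpr fun k hk => by omega⟩

/-- `C_m ∩ C_d^⊥`. -/
def Wsub (F : Type) [Field F] (n d m : ℕ) : Submodule F (Vn F n) where
  carrier := {v | v ∈ Cl F n m ∧ ∀ c ∈ Cl F n d, sB F n c v = 0}
  zero_mem' := ⟨zero_mem _, fun _ _ => sB_zero_right _⟩
  add_mem' := fun ha hb => ⟨add_mem ha.1 hb.1, fun c hc => by
    rw [sB_add_right, ha.2 c hc, hb.2 c hc, add_zero]⟩
  smul_mem' := fun r _ ha => ⟨Submodule.smul_mem _ r ha.1, fun c hc => by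
    rw [sB_smul_right, ha.2 c hc, mul_zero]⟩

theorem Wsub_mono {d d' m m' : ℕ} (hd : d' ≤ d) (hm : m ≤ m') : Wsub F n d m ≤ Wsub F n d' m' :=
  fun _ hv => ⟨Cl_mono hm hv.1, fun c hc => hv.2 c (Cl_mono hd hc)⟩

theorem mem_Wsub_succ {d m : ℕ} {v : Vn F n} :
    v ∈ Wsub F n (d + 1) m ↔ v ∈ Wsub F n d m ∧ sB F n (eb F n d) v = 0 := by
  refine ⟨fun h => ⟨Wsub_mono d.le_succ le_rfl h, h.2 _ (eb_mem_Cl d.lt_succ_self)⟩,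
    fun h => ⟨h.1.1, fun c hc => ?_⟩⟩
  obtain ⟨r, hr⟩ := exists_of_mem_Cl_succ hc
  have h1 := h.1.2 _ hr
  rw [sB_sub_left, sB_smul_left, h.2] at h1
  simpa using h1

/-- The symplectic transvection `x ↦ x + c s(x, v) v`. -/
def transvec (v : Vn F n) (c : F) : Vn F n ≃ₗ[F] Vn F n where
  toFun x := x + (c * sB F n x v) • v
  invFun x := x - (c * sB F n x v) • v
  map_add' x y := by simp only [sB_add_left]; module
  map_smul' r x := by simp only [sB_smul_left, RingHom.id_apply]; module
  left_inv x := by simp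
  right_inv x := by simp

theorem transvec_apply (v x : Vn F n) (c : F) :
    transvec v c x = x + (c * sB F n x v) • v := rfl

/-- The group generated by the transvections in directions from `C_m ∩ C_d^⊥`. -/
def TW (F : Type) [Field F] (n d m : ℕ) : Subgroup (Vn F n ≃ₗ[F] Vn F n) :=
  Subgroup.closure {g | ∃ v ∈ Wsub F n d m, ∃ c, g = transvec v c}

theorem transvec_mem_TW {d m : ℕ} {v : Vn F n} (hv : v ∈ Wsub F n d m) (c : F) :
    transvec v c ∈ TW F n d m := Subgroup.subset_closure ⟨v, hv, c, rfl⟩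

theorem map_Cl_eq {g : Vn F n ≃ₗ[F] Vn F n} {l : ℕ} (h : ∀ v ∈ Cl F n l, g v ∈ Cl F n l) :
    Submodule.map (g : Vn F n →ₗ[F] Vn F n) (Cl F n l) = Cl F n l := by
  refine Submodule.eq_of_le_of_finrank_eq (Submodule.map_le_iff_le_comap.mpr h) ?_
  exact LinearEquiv.finrank_map_eq g _

theorem mem_Par {J : Finset ℕ} {g : Vn F n ≃ₗ[F] Vn F n} :
    g ∈ Par F n J ↔ (∀ v w, sB F n (g v) (g w) = sB F n v w) ∧
      ∀ l ∉ J, ∀ v ∈ Cl F n l, g v ∈ Cl F n l := by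
  constructor
  · rintro ⟨h1, h2⟩
    refine ⟨h1, fun l hl v hv => ?_⟩
    by_cases hl1 : l = 0
    · subst hl1
      have : v = 0 := funext fun k => mem_Cl.mp hv k (Nat.zero_le _)
      rw [this, map_zero]; exact zero_mem _
    by_cases hl2 : 2 * n ≤ l
    · exact mem_Cl.mpr fun k hk => by omega
    have := h2 l ⟨Finset.mem_Icc.mpr (by omega), hl⟩
    rw [← this]
    exact Submodule.mem_map_of_mem hv
  · rintro ⟨h1, h2⟩
    exact ⟨h1, fun l hl => map_Cl_eq (h2 l hl.2)⟩

theorem Par_erase {J : Finset ℕ} {j : ℕ} {g : Vn F n ≃ₗ[F] Vn F n} :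
    g ∈ Par F n (J.erase j) ↔ g ∈ Par F n J ∧ ∀ v ∈ Cl F n j, g v ∈ Cl F n j := by
  simp only [mem_Par, Finset.mem_erase]
  constructor
  · rintro ⟨h1, h2⟩
    exact ⟨⟨h1, fun l hl => h2 l (fun h => hl h.2)⟩, h2 j (fun h => h.1 rfl)⟩
  · rintro ⟨⟨h1, h2⟩, h3⟩
    refine ⟨h1, fun l hl => ?_⟩
    by_cases e : l = j
    · subst e; exact h3
    · exact h2 l (fun h => hl ⟨e, h⟩)

theorem transvec_sB (u : Vn F n) (c : F) (v w : Vn F n) :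
    sB F n (transvec u c v) (transvec u c w) = sB F n v w := by
  simp only [transvec_apply, sB_add_left, sB_add_right, sB_smul_left, sB_smul_right, sB_self]
  rw [sB_swap w u]; ring

theorem TW_le_Par {J : Finset ℕ} {d m : ℕ} (h : ∀ l ∉ J, l ≤ d ∨ m ≤ l) :
    TW F n d m ≤ Par F n J := by
  rw [TW, Subgroup.closure_le]
  rintro _ ⟨v, hv, c, rfl⟩
  refine mem_Par.mpr ⟨transvec_sB v c, fun l hl x hx => ?_⟩
  rw [transvec_apply]
  rcases h l hl with h | h
  · rw [hv.2 x (Cl_mono h hx), mul_zero, zero_smul, add_zero]; exact hx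
  · exact add_mem hx (Submodule.smul_mem _ _ (Cl_mono h hv.1))

theorem TW_apply_of_perp {d m : ℕ} {g : Vn F n ≃ₗ[F] Vn F n} (hg : g ∈ TW F n d m) {x : Vn F n}
    (hx : ∀ v ∈ Wsub F n d m, sB F n x v = 0) : g x = x := by
  rw [TW] at hg
  induction hg using Subgroup.closure_induction with
  | mem g hg =>
    obtain ⟨v, hv, c, rfl⟩ := hg
    rw [transvec_apply, hx v hv, mul_zero, zero_smul, add_zero]
  | one => rfl
  | mul a b _ _ ha hb => rw [LinearEquiv.mul_apply, hb, ha]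
  | inv a _ ha =>
    conv_lhs => rw [← ha]
    exact a.symm_apply_apply x

theorem TW_apply_Cl {d m : ℕ} {g : Vn F n ≃ₗ[F] Vn F n} (hg : g ∈ TW F n d m) {x : Vn F n}
    (hx : x ∈ Cl F n d) : g x = x := TW_apply_of_perp hg fun _ hv => hv.2 x hx

theorem exists_TW_of_ne {d m : ℕ} {x y : Vn F n} (hxy : x - y ∈ Wsub F n d m)
    (h : sB F n x y ≠ 0) : ∃ g ∈ TW F n d m, g x = y := by
  refine ⟨_, transvec_mem_TW hxy (sB F n x y)⁻¹, ?_⟩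
  rw [transvec_apply, sB_sub_right, sB_self, zero_sub, mul_neg, inv_mul_cancel₀ h]
  module

theorem exists_TW_chain {d m : ℕ} {x y z : Vn F n} (hxz : x - z ∈ Wsub F n d m)
    (hzy : z - y ∈ Wsub F n d m) (h1 : sB F n x z ≠ 0) (h2 : sB F n z y ≠ 0) :
    ∃ g ∈ TW F n d m, g x = y := by
  obtain ⟨g, hg, eg⟩ := exists_TW_of_ne hxz h1
  obtain ⟨k, hk, ek⟩ := exists_TW_of_ne hzy h2
  exact ⟨k * g, mul_mem hk hg, by rw [LinearEquiv.mul_apply, eg, ek]⟩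

theorem exists_ne_ne {U : Submodule F (Vn F n)} {x y k l : Vn F n} (hk : k ∈ U) (hl : l ∈ U)
    (h1 : sB F n k x ≠ 0) (h2 : sB F n l y ≠ 0) :
    ∃ w ∈ U, sB F n w x ≠ 0 ∧ sB F n w y ≠ 0 := by
  by_cases h3 : sB F n k y = 0
  · by_cases h4 : sB F n l x = 0
    · exact ⟨k + l, add_mem hk hl, by simpa [h4], by simpa [h3]⟩
    · exact ⟨l, hl, h4, h2⟩
  · exact ⟨k, hk, h1, h3⟩

/-- Transvections are transitive on the vectors outside the radical of `C_m ∩ C_d^⊥`. -/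
theorem exists_TW_of_mem {d m : ℕ} {x y k l : Vn F n} (hx : x ∈ Wsub F n d m)
    (hy : y ∈ Wsub F n d m) (hk : k ∈ Wsub F n d m) (hl : l ∈ Wsub F n d m)
    (h1 : sB F n k x ≠ 0) (h2 : sB F n l y ≠ 0) : ∃ g ∈ TW F n d m, g x = y := by
  obtain ⟨w, hw, hwx, hwy⟩ := exists_ne_ne hk hl h1 h2
  refine exists_TW_chain (sub_mem hx hw) (sub_mem hw hy) ?_ hwy
  rw [sB_swap]; simpa using hwx

/-- Hyperbolic partners of a common vector are conjugate under its stabilizer. -/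
theorem exists_TW_of_partner {d m : ℕ} {e x y : Vn F n} (he : e ∈ Wsub F n d m)
    (hxy : x - y ∈ Wsub F n d m) (h1 : sB F n e x ≠ 0) (h2 : sB F n e x = sB F n e y) :
    ∃ g ∈ TW F n d m, g x = y := by
  by_cases h : sB F n x y = 0
  · refine exists_TW_chain (z := y + e) ?_ ?_ ?_ ?_
    · rw [← sub_sub]; exact sub_mem hxy he
    · rwa [add_sub_cancel_left]
    · rw [sB_add_right, h, zero_add, sB_swap]; simpa using h1
    · rw [sB_add_left, sB_self, zero_add, ← h2]; exact h1
  · exact exists_TW_of_ne hxy h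

end Symplectic

section Block

variable {F : Type} [Field F] {n : ℕ} {J : Finset ℕ} {d m : ℕ}

theorem Par_apply_Cl {g : Vn F n ≃ₗ[F] Vn F n} (hg : g ∈ Par F n J) {l : ℕ} (hl : l ∉ J)
    {v : Vn F n} (hv : v ∈ Cl F n l) : g v ∈ Cl F n l := (mem_Par.mp hg).2 l hl v hv

theorem Par_sB {g : Vn F n ≃ₗ[F] Vn F n} (hg : g ∈ Par F n J) (v w : Vn F n) :
    sB F n (g v) (g w) = sB F n v w := (mem_Par.mp hg).1 v w

theorem Par_sB_inv {g : Vn F n ≃ₗ[F] Vn F n} (hg : g ∈ Par F n J) (v w : Vn F n) :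
    sB F n v (g w) = sB F n (g⁻¹ v) w := by
  rw [← Par_sB hg (g⁻¹ v) w]
  congr 1
  exact (g.apply_symm_apply v).symm

theorem Par_apply_Wsub {g : Vn F n ≃ₗ[F] Vn F n} (hg : g ∈ Par F n J) (hd : d ∉ J) (hm : m ∉ J)
    {v : Vn F n} (hv : v ∈ Wsub F n d m) : g v ∈ Wsub F n d m :=
  ⟨Par_apply_Cl hg hm hv.1, fun c hc => by
    rw [Par_sB_inv hg]
    exact hv.2 _ (Par_apply_Cl (inv_mem hg) hd hc)⟩

theorem TW_apply_Wsub {g : Vn F n ≃ₗ[F] Vn F n} (hg : g ∈ TW F n d m) {v : Vn F n}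
    (hv : v ∈ Wsub F n d m) : g v ∈ Wsub F n d m :=
  Par_apply_Wsub (J := Finset.Ioo d m)
    (TW_le_Par (fun l hl => by simp only [Finset.mem_Ioo] at hl; omega) hg) (by simp) (by simp) hv

theorem mem_Par_erase_succ (hd : d ∉ J) {g : Vn F n ≃ₗ[F] Vn F n} :
    g ∈ Par F n (J.erase (d + 1)) ↔ g ∈ Par F n J ∧ g (eb F n d) ∈ Cl F n (d + 1) := by
  rw [Par_erase]
  refine and_congr_right fun hg => ⟨fun h => h _ (eb_mem_Cl d.lt_succ_self), fun h v hv => ?_⟩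
  obtain ⟨c, hc⟩ := exists_of_mem_Cl_succ hv
  have h1 := Cl_mono d.le_succ (Par_apply_Cl hg hd hc)
  have : g v = g (v - c • eb F n d) + c • g (eb F n d) := by rw [map_sub, map_smul]; module
  rw [this]
  exact add_mem h1 (Submodule.smul_mem _ c h)

/-- `d` and `m` are outside of `J` and everything between them is in `J`. -/
structure IsBlock (n : ℕ) (J : Finset ℕ) (d m : ℕ) : Prop where
  left_notMem : d ∉ J
  right_notMem : m ∉ J
  lt : d < m
  le : m ≤ 2 * n
  mem : ∀ l, d < l → l < m → l ∈ J

namespace IsBlock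

variable (b : IsBlock n J d m)
include b

theorem TW_le {d' m' : ℕ} (hd : d ≤ d') (hm : m' ≤ m) : TW F n d' m' ≤ Par F n J :=
  TW_le_Par fun l hl => by
    by_contra! h
    exact hl (b.mem l (by omega) (by omega))

theorem TW_le_erase {d' m' j : ℕ} (hd : d ≤ d') (hm : m' ≤ m) (hj : j ≤ d' ∨ m' ≤ j) :
    TW F n d' m' ≤ Par F n (J.erase j) :=
  TW_le_Par fun l hl => by
    by_contra! h
    exact hl (Finset.mem_erase.mpr ⟨by omega, b.mem l (by omega) (by omega)⟩)

theorem line_unique {h t t' : Vn F n ≃ₗ[F] Vn F n} (hh : h ∈ Par F n (J.erase (d + 1)))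
    (ht : t ∈ Par F n (J.erase (d + 2))) (ht1 : t ∉ Par F n (J.erase (d + 1)))
    (ht' : t' ∈ Par F n (J.erase (d + 2))) (hp : t'⁻¹ * (h * t) ∈ Par F n (J.erase (d + 1))) :
    h ∈ Par F n (J.erase (d + 2)) := by
  have hd := b.left_notMem
  have e1 : eb F n d ∈ Cl F n (d + 2) := eb_mem_Cl (by omega)
  obtain ⟨β, hβ⟩ := exists_of_mem_Cl_succ ((Par_erase.mp ht).2 _ e1)
  have hβ0 : β ≠ 0 := by
    rintro rfl
    rw [zero_smul, sub_zero] at hβ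
    exact ht1 ((mem_Par_erase_succ hd).mpr ⟨(Par_erase.mp ht).1, hβ⟩)
  have h1 : h (t (eb F n d)) ∈ Cl F n (d + 2) := by
    have := (Par_erase.mp ht').2 _ (Cl_mono (Nat.le_succ _) ((mem_Par_erase_succ hd).mp hp).2)
    have e : t' ((t'⁻¹ * (h * t)) (eb F n d)) = h (t (eb F n d)) := t'.apply_symm_apply _
    rwa [e] at this
  have hC : ∀ c ∈ Cl F n (d + 1), h c ∈ Cl F n (d + 2) := fun c hc =>
    Cl_mono (Nat.le_succ _) ((Par_erase.mp hh).2 c hc)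
  have h2 : h (eb F n (d + 1)) ∈ Cl F n (d + 2) := by
    have := Submodule.smul_mem _ β⁻¹ (sub_mem h1 (hC _ hβ))
    rwa [← map_sub, sub_sub_cancel, map_smul, smul_smul, inv_mul_cancel₀ hβ0, one_smul] at this
  refine Par_erase.mpr ⟨(Par_erase.mp hh).1, fun v hv => ?_⟩
  obtain ⟨c, hc⟩ := exists_of_mem_Cl_succ (l := d + 1) hv
  have : h v = h (v - c • eb F n (d + 1)) + c • h (eb F n (d + 1)) := by
    rw [map_sub, map_smul]; module
  rw [this]
  exact add_mem (hC _ hc) (Submodule.smul_mem _ c h2)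

end IsBlock

/-- If `|K| ≥ 3` then some scalar avoids two given ones. -/
theorem exists_ne_and_ne {K : Type} (hF : 2 < Cardinal.mk K) (a b : K) :
    ∃ c : K, c ≠ a ∧ c ≠ b := by
  obtain ⟨c, hc⟩ := Cardinal.exists_notMem_of_length_lt [a, b] (by simpa using hF)
  simp only [List.mem_cons, List.not_mem_nil, or_false, not_or] at hc
  exact ⟨c, hc⟩

theorem exists_add_mul_ne (hF : 2 < Cardinal.mk F) {p q r s : F} (h1 : p ≠ 0 ∨ q ≠ 0)
    (h2 : r ≠ 0 ∨ s ≠ 0) : ∃ c : F, p + c * q ≠ 0 ∧ r + c * s ≠ 0 := by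
  obtain ⟨c, hc1, hc2⟩ := exists_ne_and_ne hF (-p / q) (-r / s)
  refine ⟨c, fun h => ?_, fun h => ?_⟩
  · by_cases hq : q = 0
    · simp_all
    · exact hc1 (by field_simp; linear_combination h)
  · by_cases hs : s = 0
    · simp_all
    · exact hc2 (by field_simp; linear_combination h)

/-- As above, but avoiding `0` as well as the root of a nontrivial affine function. -/
theorem exists_ne_zero_add_mul_ne (hF : 2 < Cardinal.mk F) {p q : F} (h : p ≠ 0 ∨ q ≠ 0) :
    ∃ c : F, c ≠ 0 ∧ p + c * q ≠ 0 := by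
  obtain ⟨c, h1, h2⟩ := exists_add_mul_ne hF (p := 0) (q := 1) (Or.inr one_ne_zero) h
  exact ⟨c, by simpa using h1, h2⟩

end Block

section Even

variable {F : Type} [Field F] {n : ℕ} {J : Finset ℕ} {d m : ℕ}

theorem eb_mem_Wsub_of_even {k : ℕ} (hk : Even k) (hd : d ≤ k + 1) (hm : k < m)
    (h : k + 1 < 2 * n) : eb F n k ∈ Wsub F n d m :=
  ⟨eb_mem_Cl hm, fun c hc => by
    rw [sB_swap, sB_eb_even hk h, mem_Cl.mp hc _ hd, neg_zero]⟩

theorem eb_mem_Wsub_of_odd {k : ℕ} (hk : Even k) (hd : d ≤ k) (hm : k + 1 < m)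
    (h : k + 1 < 2 * n) : eb F n (k + 1) ∈ Wsub F n d m :=
  ⟨eb_mem_Cl hm, fun c hc => by
    rw [sB_swap, sB_eb_odd hk h, mem_Cl.mp hc _ hd, neg_zero, neg_zero]⟩

theorem sB_eb_pair {k : ℕ} (hk : Even k) (h : k + 1 < 2 * n) :
    sB F n (eb F n k) (eb F n (k + 1)) = 1 := by
  rw [sB_eb_even hk h]; simp [eb]

theorem sB_eb_pair' {k : ℕ} (hk : Even k) (h : k + 1 < 2 * n) :
    sB F n (eb F n (k + 1)) (eb F n k) = -1 := by
  rw [sB_swap, sB_eb_pair hk h]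

theorem apply_eq_zero_of_mem_Wsub (hd : Even d) {v : Vn F n} (hv : v ∈ Wsub F n d m)
    {i : Fin (2 * n)} (hi : i < d) : v i = 0 := by
  rw [Nat.even_iff] at hd
  have hi2 := i.2
  rcases Nat.even_or_odd' i with ⟨k, hk | hk⟩
  · have h1 := hv.2 _ (eb_mem_Cl (show 2 * k + 1 < d by omega))
    rw [sB_eb_odd (by simp) (by omega)] at h1
    rw [← neg_eq_zero, ← h1]
    congr 2; exact Fin.ext hk
  · have h1 := hv.2 _ (eb_mem_Cl (show 2 * k < d by omega))
    rw [sB_eb_even (by simp) (by omega)] at h1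
    rw [← h1]
    congr 1; exact Fin.ext hk

theorem eq_smul_of_mem_Wsub (hd : Even d) {v : Vn F n} (hv : v ∈ Wsub F n d m)
    (hv' : v ∈ Cl F n (d + 1)) : ∃ c : F, v = c • eb F n d := by
  obtain ⟨c, hc⟩ := exists_of_mem_Cl_succ hv'
  refine ⟨c, funext fun i => ?_⟩
  rcases lt_or_ge (i : ℕ) d with h | h
  · rw [apply_eq_zero_of_mem_Wsub hd hv h]
    simp [eb, h.ne]
  · have := mem_Cl.mp hc i h
    rwa [Pi.sub_apply, sub_eq_zero] at this

theorem inv_mul_mem_Par_erase (hd : d ∉ J) {x y : Vn F n ≃ₗ[F] Vn F n} (hx : x ∈ Par F n J)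
    (hy : y ∈ Par F n J) {c : Vn F n} (hc : c ∈ Cl F n (d + 1)) (h : y (eb F n d) = x c) :
    x⁻¹ * y ∈ Par F n (J.erase (d + 1)) := by
  refine (mem_Par_erase_succ hd).mpr ⟨mul_mem (inv_mem hx) hy, ?_⟩
  rw [LinearEquiv.mul_apply, h]
  convert hc using 1
  exact x.symm_apply_apply c

theorem inv_mul_mem_Par_erase_of_smul (hd : d ∉ J) {x y : Vn F n ≃ₗ[F] Vn F n}
    (hx : x ∈ Par F n J) (hy : y ∈ Par F n J) (c : F) (h : y (eb F n d) = c • x (eb F n d)) :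
    x⁻¹ * y ∈ Par F n (J.erase (d + 1)) :=
  inv_mul_mem_Par_erase hd hx hy
    (Submodule.smul_mem _ c (eb_mem_Cl d.lt_succ_self)) (by rw [h, map_smul])

/-- Non-orthogonality of the points represented by `x` and `y`. -/
def NonPerp (F : Type) [Field F] (n d : ℕ) (x y : Vn F n ≃ₗ[F] Vn F n) : Prop :=
  sB F n (x (eb F n d)) (y (eb F n d)) ≠ 0

theorem NonPerp.smul {g x y : Vn F n ≃ₗ[F] Vn F n} (hg : g ∈ Par F n J)
    (h : NonPerp F n d x y) : NonPerp F n d (g * x) (g * y) := by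
  unfold NonPerp
  rw [LinearEquiv.mul_apply, LinearEquiv.mul_apply, Par_sB hg]
  exact h

namespace IsBlock

variable (b : IsBlock n J d m)
include b

theorem apply_eb_of_even (hd : Even d) {p : Vn F n ≃ₗ[F] Vn F n}
    (hp : p ∈ Par F n (J.erase (d + 1))) : ∃ c : F, p (eb F n d) = c • eb F n d := by
  have hp' := (mem_Par_erase_succ b.left_notMem).mp hp
  have := b.lt
  have := b.le
  rw [Nat.even_iff] at hd
  exact eq_smul_of_mem_Wsub (Nat.even_iff.mpr hd) (Par_apply_Wsub hp'.1 b.left_notMem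
    b.right_notMem (eb_mem_Wsub_of_even (Nat.even_iff.mpr hd) (by omega) b.lt (by omega))) hp'.2

theorem eb_mem_Wsub (hd : Even d) : eb F n d ∈ Wsub F n d m := by
  have := b.lt
  have := b.le
  rw [Nat.even_iff] at hd
  exact eb_mem_Wsub_of_even (Nat.even_iff.mpr hd) (by omega) b.lt (by omega)

theorem apply_eb_mem_Wsub (hd : Even d) {g : Vn F n ≃ₗ[F] Vn F n} (hg : g ∈ Par F n J) :
    g (eb F n d) ∈ Wsub F n d m :=
  Par_apply_Wsub hg b.left_notMem b.right_notMem (b.eb_mem_Wsub hd)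

theorem exists_apply_eb_eq (hd : Even d) {v : Vn F n} (hv : v ∈ Wsub F n d m)
    (h : sB F n (eb F n d) v ≠ 0) : ∃ w ∈ Par F n J, w (eb F n d) = v := by
  obtain ⟨w, hw, e⟩ := exists_TW_of_ne (sub_mem (b.eb_mem_Wsub hd) hv) h
  exact ⟨w, b.TW_le le_rfl le_rfl hw, e⟩

theorem exists_hyperbolic (hd : Even d) {m' : ℕ} (h1 : d + 2 ≤ m') (h2 : m' ≤ m)
    {g : Vn F n ≃ₗ[F] Vn F n} (hg : g ∈ Par F n J) (hm : g (eb F n d) ∈ Cl F n m')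
    (h : NonPerp F n d 1 g) : ∃ h ∈ TW F n (d + 1) m', ∃ c : F, c ≠ 0 ∧
      g (eb F n d) = c • h (eb F n (d + 1)) := by
  have hle := b.le
  have hn : d + 1 < 2 * n := by omega
  change sB F n (eb F n d) (g (eb F n d)) ≠ 0 at h
  obtain ⟨c, hc⟩ : ∃ c, c = sB F n (eb F n d) (g (eb F n d)) := ⟨_, rfl⟩
  rw [← hc] at h
  have hy : g (eb F n d) ∈ Wsub F n d m' := ⟨hm, (b.apply_eb_mem_Wsub hd hg).2⟩
  obtain ⟨k, hk, e⟩ := exists_TW_of_partner (d := d + 1) (m := m') (e := eb F n d)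
    (x := eb F n (d + 1)) (y := c⁻¹ • g (eb F n d))
    (eb_mem_Wsub_of_even hd (by omega) (by omega) hn)
    (mem_Wsub_succ.mpr ⟨sub_mem (eb_mem_Wsub_of_odd hd le_rfl (by omega) hn)
      (Submodule.smul_mem _ _ hy), by
        rw [sB_sub_right, sB_eb_pair hd hn, sB_smul_right, ← hc, inv_mul_cancel₀ h, sub_self]⟩)
    (by rw [sB_eb_pair hd hn]; exact one_ne_zero)
    (by rw [sB_eb_pair hd hn, sB_smul_right, ← hc, inv_mul_cancel₀ h])
  exact ⟨k, hk, c, h, by rw [e, smul_smul, mul_inv_cancel₀ h, one_smul]⟩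

theorem edge_of_even (hd : Even d) {m' : ℕ} (h1 : d + 2 ≤ m') (h2 : m' ≤ m)
    {g : Vn F n ≃ₗ[F] Vn F n} (hg : g ∈ Par F n J) (hm : g (eb F n d) ∈ Cl F n m')
    (h : NonPerp F n d 1 g) : ∃ h ∈ TW F n (d + 1) m', ∃ t ∈ TW F n d (d + 2),
      (h * t)⁻¹ * g ∈ Par F n (J.erase (d + 1)) := by
  have hle := b.le
  have hn : d + 1 < 2 * n := by omega
  obtain ⟨k, hk, c, hc, e⟩ := b.exists_hyperbolic hd h1 h2 hg hm h
  obtain ⟨t, ht, e'⟩ := exists_TW_of_ne (d := d) (m := d + 2) (x := eb F n d)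
    (y := eb F n (d + 1)) (sub_mem (eb_mem_Wsub_of_even hd (by omega) (by omega) hn)
      (eb_mem_Wsub_of_odd hd le_rfl (by omega) hn))
    (by rw [sB_eb_pair hd hn]; exact one_ne_zero)
  refine ⟨k, hk, t, ht, inv_mul_mem_Par_erase_of_smul b.left_notMem
    (mul_mem (b.TW_le d.le_succ h2 hk) (b.TW_le le_rfl (by omega) ht)) hg c ?_⟩
  rw [LinearEquiv.mul_apply, e', e]

theorem dichotomy_of_even (hd : Even d) (h2 : d + 2 ≤ m) {t : Vn F n ≃ₗ[F] Vn F n}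
    (ht : t ∈ Par F n (J.erase (d + 2))) :
    t ∈ Par F n (J.erase (d + 1)) ∨ NonPerp F n d 1 t := by
  have hle := b.le
  rw [Par_erase] at ht
  refine or_iff_not_imp_right.mpr fun h => (mem_Par_erase_succ b.left_notMem).mpr ⟨ht.1, ?_⟩
  have h : sB F n (eb F n d) (t (eb F n d)) = 0 := not_not.mp h
  rw [sB_eb_even hd (by omega)] at h
  have h1 := ht.2 _ (eb_mem_Cl (show d < d + 2 by omega))
  refine mem_Cl.mpr fun i hi => ?_
  rcases hi.eq_or_lt with hi | hi
  · have e : i = ⟨d + 1, by omega⟩ := Fin.ext hi.symm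
    rw [e]
    exact h
  · exact mem_Cl.mp h1 i hi

theorem diameter_of_even (hd : Even d) (h2 : d + 2 ≤ m) {g : Vn F n ≃ₗ[F] Vn F n}
    (hg : g ∈ Par F n J) : ∃ w ∈ Par F n J, NonPerp F n d 1 w ∧ NonPerp F n d w g := by
  have hle := b.le
  have hn : d + 1 < 2 * n := by omega
  have hf : eb F n (d + 1) ∈ Wsub F n d m := eb_mem_Wsub_of_odd hd le_rfl (by omega) hn
  obtain ⟨v, hv, h1, h2⟩ := exists_ne_ne (x := eb F n d) (y := g (eb F n d)) hf
    (Par_apply_Wsub hg b.left_notMem b.right_notMem hf)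
    (by rw [sB_eb_pair' hd hn]; simp) (by rw [Par_sB hg, sB_eb_pair' hd hn]; simp)
  have h1' : sB F n (eb F n d) v ≠ 0 := by rw [sB_swap]; simpa using h1
  obtain ⟨w, hw, rfl⟩ := b.exists_apply_eb_eq hd hv h1'
  exact ⟨w, hw, h1', h2⟩

theorem path_of_even (hF : 2 < Cardinal.mk F) (hd : Even d) {z x y : Vn F n ≃ₗ[F] Vn F n}
    (hz : z ∈ Par F n J) (hx : x ∈ Par F n J) (hy : y ∈ Par F n J) (h1 : NonPerp F n d 1 z)
    (h2 : NonPerp F n d z x) (h3 : NonPerp F n d x y) :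
    NonPerp F n d 1 x ∨ NonPerp F n d z y ∨ ∃ w ∈ Par F n J,
      NonPerp F n d 1 w ∧ NonPerp F n d z w ∧ NonPerp F n d x w ∧ NonPerp F n d y w := by
  by_cases h4 : NonPerp F n d 1 x
  · exact Or.inl h4
  by_cases h5 : NonPerp F n d z y
  · exact Or.inr (Or.inl h5)
  refine Or.inr (Or.inr ?_)
  have hzW := b.apply_eb_mem_Wsub hd hz
  have hxW := b.apply_eb_mem_Wsub hd hx
  have hyW := b.apply_eb_mem_Wsub hd hy
  have heW := b.eb_mem_Wsub (F := F) hd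
  simp only [NonPerp, not_not, LinearEquiv.coe_one, id_eq] at h1 h2 h3 h4 h5 ⊢
  obtain ⟨δ, hδ1, hδ2⟩ := exists_add_mul_ne hF (p := sB F n (eb F n d) (z (eb F n d)))
    (q := sB F n (eb F n d) (y (eb F n d))) (r := sB F n (x (eb F n d)) (z (eb F n d)))
    (s := sB F n (x (eb F n d)) (y (eb F n d))) (Or.inl h1) (Or.inr h3)
  obtain ⟨β, hβ1, hβ2⟩ := exists_add_mul_ne hF (p := sB F n (z (eb F n d)) (eb F n d))
    (q := sB F n (z (eb F n d)) (x (eb F n d))) (r := sB F n (y (eb F n d)) (eb F n d))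
    (s := sB F n (y (eb F n d)) (x (eb F n d))) (Or.inr h2)
    (Or.inr (by rw [sB_swap]; simpa using h3))
  have h4' : sB F n (x (eb F n d)) (eb F n d) = 0 := by rw [sB_swap, h4, neg_zero]
  have h5' : sB F n (y (eb F n d)) (z (eb F n d)) = 0 := by rw [sB_swap, h5, neg_zero]
  have he : sB F n (eb F n d) (eb F n d + β • x (eb F n d) + z (eb F n d) + δ • y (eb F n d)) ≠ 0 := by
    simpa [h4] using hδ1
  obtain ⟨w, hw, ew⟩ := b.exists_apply_eb_eq hd
    (add_mem (add_mem (add_mem heW (Submodule.smul_mem _ β hxW)) hzW)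
      (Submodule.smul_mem _ δ hyW)) he
  refine ⟨w, hw, ?_⟩
  rw [ew]
  exact ⟨he, by simpa [h5] using hβ1, by simpa [h4'] using hδ2, by simpa [h5'] using hβ2⟩

theorem coplanar_one_of_even (hd : Even d) (h4 : d + 4 ≤ m) {y z : Vn F n ≃ₗ[F] Vn F n}
    (hy : y ∈ Par F n J) (hz : z ∈ Par F n J) (h1y : NonPerp F n d 1 y) (h1z : NonPerp F n d 1 z)
    {k : Vn F n} (hk : k ∈ Wsub F n d m) (hk1 : sB F n k (eb F n d) = 0)
    (hky : sB F n k (y (eb F n d)) = 0) (hkz : sB F n k (z (eb F n d)) ≠ 0) :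
    IsCoplanarTriple (Par F n J) (Par F n (J.erase (d + 1))) (Par F n (J.erase (d + 3))) 1 y z := by
  have hle := b.le
  have hn : d + 1 < 2 * n := by omega
  have hd2 : Even (d + 2) := by simpa [parity_simps] using hd
  obtain ⟨h, hh, c, hc, ey⟩ := b.exists_hyperbolic hd (by omega) le_rfl hy
    (b.apply_eb_mem_Wsub hd hy).1 h1y
  have hhG := b.TW_le d.le_succ le_rfl hh
  have hie : h⁻¹ (eb F n d) = eb F n d := TW_apply_Cl (inv_mem hh) (eb_mem_Cl d.lt_succ_self)
  obtain ⟨v, ev⟩ : ∃ v, v = h⁻¹ (z (eb F n d)) := ⟨_, rfl⟩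
  obtain ⟨l, el⟩ : ∃ l, l = h⁻¹ k := ⟨_, rfl⟩
  have hev : h v = z (eb F n d) := by rw [ev]; exact h.apply_symm_apply _
  have hek : h l = k := by rw [el]; exact h.apply_symm_apply _
  have hhe : h (eb F n d) = eb F n d := TW_apply_Cl hh (eb_mem_Cl d.lt_succ_self)
  have hvW : v ∈ Wsub F n d m := by
    rw [ev]
    exact Par_apply_Wsub (inv_mem hhG) b.left_notMem b.right_notMem (b.apply_eb_mem_Wsub hd hz)
  have hlW : l ∈ Wsub F n d m := by
    rw [el]; exact Par_apply_Wsub (inv_mem hhG) b.left_notMem b.right_notMem hk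
  have hfW : eb F n (d + 1) ∈ Wsub F n d m := eb_mem_Wsub_of_odd hd le_rfl (by omega) hn
  have heW := b.eb_mem_Wsub (F := F) hd
  have hlf : sB F n (eb F n (d + 1)) l = 0 := by
    rw [← Par_sB hhG, hek, sB_swap]
    rw [ey, sB_smul_right] at hky
    simpa [hc] using hky
  have hle' : sB F n (eb F n d) l = 0 := by
    rw [← Par_sB hhG, hek, hhe, sB_swap, hk1, neg_zero]
  have hlW2 : l ∈ Wsub F n (d + 2) m := mem_Wsub_succ.mpr ⟨mem_Wsub_succ.mpr ⟨hlW, hle'⟩, hlf⟩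
  have hlv : sB F n l v ≠ 0 := by rwa [← Par_sB hhG, hek, hev]
  have hβ : sB F n (eb F n d) v ≠ 0 := by
    rw [← Par_sB hhG, hev, hhe]; exact h1z
  obtain ⟨α, eα⟩ : ∃ α, α = sB F n (eb F n (d + 1)) v := ⟨_, rfl⟩
  obtain ⟨β, eβ⟩ : ∃ β, β = sB F n (eb F n d) v := ⟨_, rfl⟩
  have hw : v + α • eb F n d - β • eb F n (d + 1) ∈ Wsub F n (d + 2) m := by
    refine mem_Wsub_succ.mpr ⟨mem_Wsub_succ.mpr ⟨sub_mem (add_mem hvW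
      (Submodule.smul_mem _ _ heW)) (Submodule.smul_mem _ _ hfW), ?_⟩, ?_⟩
    · simp [sB_eb_pair hd hn, eβ]
    · simp [sB_eb_pair' hd hn, eα]
  obtain ⟨r, hr, er⟩ := exists_TW_of_mem
    (eb_mem_Wsub_of_even (F := F) (d := d + 2) (m := m) hd2 (by omega) (by omega) (by omega)) hw
    (eb_mem_Wsub_of_odd (F := F) (d := d + 2) (m := m) hd2 le_rfl (by omega) (by omega)) hlW2
    (by rw [sB_eb_pair' hd2 (by omega)]; simp)
    (by
      rw [sB_swap] at hle' hlf
      simpa [neg_eq_zero.mp hle', neg_eq_zero.mp hlf] using hlv)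
  have he3 : eb F n d ∈ Wsub F n d (d + 3) := eb_mem_Wsub_of_even hd (by omega) (by omega) hn
  have hf3 : eb F n (d + 1) ∈ Wsub F n d (d + 3) := eb_mem_Wsub_of_odd hd le_rfl (by omega) hn
  have hk3 : eb F n (d + 2) ∈ Wsub F n d (d + 3) :=
    eb_mem_Wsub_of_even hd2 (by omega) (by omega) (by omega)
  have hek3 : sB F n (eb F n d) (eb F n (d + 2)) = 0 := by
    rw [sB_eb_even hd hn]; simp [eb]
  obtain ⟨u, hu, eu⟩ := exists_TW_of_ne (sub_mem he3 hf3)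
    (by rw [sB_eb_pair hd hn]; exact one_ne_zero)
  obtain ⟨u', hu', eu'⟩ := exists_TW_of_ne (x := eb F n d)
    (y := (-α) • eb F n d + β • eb F n (d + 1) + eb F n (d + 2))
    (sub_mem he3 (add_mem (add_mem (Submodule.smul_mem _ _ he3) (Submodule.smul_mem _ _ hf3)) hk3))
    (by simpa [-neg_smul, hek3, sB_eb_pair hd hn, eβ] using hβ)
  have hrG := b.TW_le (show d ≤ d + 2 by omega) le_rfl hr
  have hgG := mul_mem hhG hrG
  have hre : r (eb F n d) = eb F n d := TW_apply_Cl hr (eb_mem_Cl (by omega))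
  have hrf : r (eb F n (d + 1)) = eb F n (d + 1) := TW_apply_Cl hr (eb_mem_Cl (by omega))
  have hle3 := b.TW_le_erase (F := F) (d' := d) (m' := d + 3) (j := d + 3) le_rfl (by omega)
    (Or.inr le_rfl)
  have hleG := b.TW_le (F := F) (d' := d) (m' := d + 3) le_rfl (by omega)
  refine ⟨h * r, hgG, 1, one_mem _, u, hle3 hu, u', hle3 hu', ?_, ?_, ?_⟩
  · refine inv_mul_mem_Par_erase_of_smul b.left_notMem (mul_mem hgG (one_mem _)) (one_mem _) 1 ?_
    simp [hre, hhe]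
  · refine inv_mul_mem_Par_erase_of_smul b.left_notMem (mul_mem hgG (hleG hu)) hy c ?_
    simp [eu, hrf, ey]
  · refine inv_mul_mem_Par_erase_of_smul b.left_notMem (mul_mem hgG (hleG hu')) hz 1 ?_
    rw [LinearEquiv.mul_apply, LinearEquiv.mul_apply, eu', ← hev]
    simp only [map_add, map_smul, hre, hrf, er, map_sub]
    module

theorem coplanar_of_even (hd : Even d) (h4 : d + 4 ≤ m) {x y z : Vn F n ≃ₗ[F] Vn F n}
    (hx : x ∈ Par F n J) (hy : y ∈ Par F n J) (hz : z ∈ Par F n J) (hxy : NonPerp F n d x y)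
    (hxz : NonPerp F n d x z)
    {k : Vn F n} (hk : k ∈ Wsub F n d m) (hkx : sB F n k (x (eb F n d)) = 0)
    (hky : sB F n k (y (eb F n d)) = 0) (hkz : sB F n k (z (eb F n d)) ≠ 0) :
    IsCoplanarTriple (Par F n J) (Par F n (J.erase (d + 1))) (Par F n (J.erase (d + 3))) x y z := by
  have hxi := inv_mem hx
  have e := hxy.smul hxi
  have e' := hxz.smul hxi
  rw [inv_mul_cancel] at e e'
  rw [Par_sB_inv hx] at hkx
  rw [← Par_sB hxi] at hky hkz
  have := (b.coplanar_one_of_even hd h4 (mul_mem hxi hy) (mul_mem hxi hz) e e'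
    (Par_apply_Wsub hxi b.left_notMem b.right_notMem hk) hkx hky hkz).smul hx
  simpa using this

theorem triangle_of_even (hF : 2 < Cardinal.mk F) (hd : Even d) (h4 : d + 4 ≤ m)
    {y z : Vn F n ≃ₗ[F] Vn F n}
    (hy : y ∈ Par F n J) (hz : z ∈ Par F n J) (h1y : NonPerp F n d 1 y) (h1z : NonPerp F n d 1 z)
    (hyz : NonPerp F n d y z) :
    IsCoplanarTriple (Par F n J) (Par F n (J.erase (d + 1))) (Par F n (J.erase (d + 3))) 1 y z ∨
    ∃ w ∈ Par F n J, NonPerp F n d 1 w ∧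
      IsCoplanarTriple (Par F n J) (Par F n (J.erase (d + 1))) (Par F n (J.erase (d + 3))) 1 y w ∧
      IsCoplanarTriple (Par F n J) (Par F n (J.erase (d + 1))) (Par F n (J.erase (d + 3))) 1 z w ∧
      IsCoplanarTriple (Par F n J) (Par F n (J.erase (d + 1))) (Par F n (J.erase (d + 3))) y z w ∧
      NonPerp F n d y w ∧ NonPerp F n d z w := by
  have hle := b.le
  have hn : d + 1 < 2 * n := by omega
  have hd2 : Even (d + 2) := by simpa [parity_simps] using hd
  obtain ⟨h, hh, c, hc, ey⟩ := b.exists_hyperbolic hd (by omega) le_rfl hy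
    (b.apply_eb_mem_Wsub hd hy).1 h1y
  have hhG := b.TW_le d.le_succ le_rfl hh
  have hhe : h (eb F n d) = eb F n d := TW_apply_Cl hh (eb_mem_Cl d.lt_succ_self)
  obtain ⟨k, ek⟩ : ∃ k, k = h (eb F n (d + 3)) := ⟨_, rfl⟩
  obtain ⟨l, el⟩ : ∃ l, l = h (eb F n (d + 2)) := ⟨_, rfl⟩
  obtain ⟨f, ef⟩ : ∃ f, f = h (eb F n (d + 1)) := ⟨_, rfl⟩
  have hkW : k ∈ Wsub F n d m := by
    rw [ek]
    exact Par_apply_Wsub hhG b.left_notMem b.right_notMem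
      (eb_mem_Wsub_of_odd hd2 (by omega) (by omega) (by omega))
  have hlW : l ∈ Wsub F n d m := by
    rw [el]
    exact Par_apply_Wsub hhG b.left_notMem b.right_notMem
      (eb_mem_Wsub_of_even hd2 (by omega) (by omega) (by omega))
  have hfW : f ∈ Wsub F n d m := by
    rw [ef]
    exact Par_apply_Wsub hhG b.left_notMem b.right_notMem
      (eb_mem_Wsub_of_odd hd (by omega) (by omega) (by omega))
  have heW := b.eb_mem_Wsub (F := F) hd
  have h1k : sB F n k (eb F n d) = 0 := by
    rw [ek, ← hhe, Par_sB hhG, sB_eb_odd hd2 (by omega)]; simp [eb]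
  have hfk : sB F n k f = 0 := by
    rw [ek, ef, Par_sB hhG, sB_eb_odd hd2 (by omega)]; simp [eb]
  have hlk : sB F n k l = -1 := by
    rw [ek, el, Par_sB hhG, sB_eb_pair' hd2 (by omega)]
  have hef : sB F n (eb F n d) f = 1 := by
    rw [ef, ← hhe, Par_sB hhG, sB_eb_pair hd hn]
  have hel : sB F n (eb F n d) l = 0 := by
    rw [el, ← hhe, Par_sB hhG, sB_eb_even hd hn]; simp [eb]
  have hfl : sB F n f l = 0 := by
    rw [el, ef, Par_sB hhG, sB_eb_odd hd hn]; simp [eb]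
  rw [← ef] at ey
  have hky : sB F n k (y (eb F n d)) = 0 := by rw [ey, sB_smul_right, hfk, mul_zero]
  by_cases hkz : sB F n k (z (eb F n d)) = 0
  swap
  · exact Or.inl (b.coplanar_of_even hd h4 (one_mem _) hy hz h1y h1z hkW h1k hky hkz)
  have hzf : sB F n (z (eb F n d)) f ≠ 0 := by
    intro h0
    rw [NonPerp, ey, sB_smul_left, sB_swap, h0] at hyz
    simp at hyz
  obtain ⟨δ, hδ, hδ'⟩ := exists_ne_zero_add_mul_ne hF
    (p := sB F n (z (eb F n d)) (eb F n d) + sB F n (z (eb F n d)) l)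
    (q := sB F n (z (eb F n d)) f) (Or.inr hzf)
  have hew : sB F n (eb F n d) (eb F n d + δ • f + l) ≠ 0 := by simpa [hef, hel] using hδ
  obtain ⟨w, hw, ew⟩ := b.exists_apply_eb_eq hd
    (add_mem (add_mem heW (Submodule.smul_mem _ δ hfW)) hlW) hew
  have hkw : sB F n k (w (eb F n d)) ≠ 0 := by simp [ew, h1k, hfk, hlk]
  have h1w : NonPerp F n d 1 w := by
    change sB F n (eb F n d) (w (eb F n d)) ≠ 0
    rwa [ew]
  have hyw : NonPerp F n d y w := by
    rw [NonPerp, ew, ey]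
    simp [hfl, hc, sB_swap (eb F n d) f, hef]
  have hzw : NonPerp F n d z w := by
    rw [NonPerp, ew]
    simp only [sB_add_right, sB_smul_right]
    convert hδ' using 1
    ring
  exact Or.inr ⟨w, hw, h1w, b.coplanar_of_even hd h4 (one_mem _) hy hw h1y h1w hkW h1k hky hkw,
    b.coplanar_of_even hd h4 (one_mem _) hz hw h1z h1w hkW h1k hkz hkw,
    b.coplanar_of_even hd h4 hy hz hw hyz hyw hkW hky hkz hkw, hyw, hzw⟩

theorem triangleGeometry_of_even (hF : 2 < Cardinal.mk F) (hd : Even d) (h4 : d + 4 ≤ m) :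
    TriangleGeometry (Par F n J) (Par F n (J.erase (d + 1))) (Par F n (J.erase (d + 2)))
      (Par F n (J.erase (d + 3))) (NonPerp F n d) where
  le₁ := Par_mono F n (Finset.erase_subset _ _)
  le₂ := Par_mono F n (Finset.erase_subset _ _)
  le₃ := Par_mono F n (Finset.erase_subset _ _)
  smul hg _ _ h := NonPerp.smul hg h
  symm {x y} h := by unfold NonPerp at *; rw [sB_swap]; simpa using h
  right {x y p} hx hy hp h := by
    obtain ⟨c, hc⟩ := b.apply_eb_of_even hd hp
    have hc0 : c ≠ 0 := by
      rintro rfl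
      rw [zero_smul, LinearEquiv.map_eq_zero_iff] at hc
      simp [NonPerp, hc] at h
    unfold NonPerp at *
    rw [LinearEquiv.mul_apply, hc, map_smul, sB_smul_right]
    exact mul_ne_zero hc0 h
  irrefl {p} hp := by
    obtain ⟨c, hc⟩ := b.apply_eb_of_even hd hp
    simp [NonPerp, hc]
  dichotomy ht := b.dichotomy_of_even hd (by omega) ht
  edge {g} hg h := by
    obtain ⟨k, hk, t, ht, hp⟩ := b.edge_of_even hd (by omega) le_rfl hg
      (b.apply_eb_mem_Wsub hd hg).1 h
    exact ⟨k, b.TW_le_erase (by omega) le_rfl (by omega) hk,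
      t, b.TW_le_erase le_rfl (by omega) (by omega) ht, hp⟩
  line_unique := b.line_unique
  plane {u} hu h := by
    rw [Par_erase] at hu
    obtain ⟨k, hk, t, ht, hp⟩ := b.edge_of_even hd (m' := d + 3) (by omega) (by omega) hu.1
      (hu.2 _ (eb_mem_Cl (by omega))) h
    exact ⟨k, ⟨b.TW_le_erase (by omega) (by omega) (by omega) hk,
      b.TW_le_erase (by omega) (by omega) (by omega) hk⟩,
      t, ⟨b.TW_le_erase le_rfl (by omega) (by omega) ht,
      b.TW_le_erase le_rfl (by omega) (by omega) ht⟩, hp⟩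
  triangle := b.triangle_of_even hF hd h4
  diameter := b.diameter_of_even hd (by omega)
  path := b.path_of_even hF hd

theorem le_sup_of_even (hd : Even d) (h2 : d + 2 ≤ m) :
    Par F n J ≤ Par F n (J.erase (d + 1)) ⊔ Par F n (J.erase (d + 2)) :=
  le_sup_of_diameter (A := NonPerp F n d) (fun hg _ _ h => NonPerp.smul hg h)
    (fun {g} hg h => by
      obtain ⟨k, hk, t, ht, hp⟩ := b.edge_of_even hd (by omega) le_rfl hg
        (b.apply_eb_mem_Wsub hd hg).1 h
      exact ⟨k, b.TW_le_erase (by omega) le_rfl (by omega) hk,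
        t, b.TW_le_erase le_rfl (by omega) (by omega) ht, hp⟩)
    (b.diameter_of_even hd (by omega))

end IsBlock

end Even

section Odd

variable {F : Type} [Field F] {n : ℕ} {J : Finset ℕ} {d m : ℕ}

theorem sB_eb_pred (hd : Odd d) (h : d < 2 * n) : sB F n (eb F n (d - 1)) (eb F n d) = 1 := by
  obtain ⟨k, rfl⟩ := hd
  exact sB_eb_pair (by simp) h

theorem sB_eb_pred' (hd : Odd d) (h : d < 2 * n) : sB F n (eb F n d) (eb F n (d - 1)) = -1 := by
  rw [sB_swap, sB_eb_pred hd h]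

theorem eb_pred_mem_Wsub (hd : Odd d) (h : d < 2 * n) (hm : d ≤ m) :
    eb F n (d - 1) ∈ Wsub F n d m := by
  obtain ⟨k, rfl⟩ := hd
  exact eb_mem_Wsub_of_even (by simp) (by omega) (by omega) h

theorem eb_pred_mem_Cl (hd : Odd d) : eb F n (d - 1) ∈ Cl F n d :=
  eb_mem_Cl (Nat.sub_lt hd.pos one_pos)

theorem sB_eb_pred_of_mem (hd : Odd d) {v : Vn F n} (hv : v ∈ Wsub F n d m) :
    sB F n (eb F n (d - 1)) v = 0 := hv.2 _ (eb_pred_mem_Cl hd)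

theorem sB_of_mem_eb_pred (hd : Odd d) {v : Vn F n} (hv : v ∈ Wsub F n d m) :
    sB F n v (eb F n (d - 1)) = 0 := by rw [sB_swap, sB_eb_pred_of_mem hd hv, neg_zero]

theorem apply_eb_pred (hd : Odd d) (h : d < 2 * n) (hdJ : d ∉ J) {g : Vn F n ≃ₗ[F] Vn F n}
    (hg : g ∈ Par F n J) : ∃ c : F, g (eb F n (d - 1)) = c • eb F n (d - 1) := by
  have h1 := Par_apply_Wsub hg hdJ hdJ (eb_pred_mem_Wsub hd h le_rfl)
  obtain ⟨k, rfl⟩ := hd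
  exact eq_smul_of_mem_Wsub (by simp) (Wsub_mono (by omega) le_rfl h1) h1.1

theorem exists_sB_eb_pred_apply (hd : Odd d) (h : d < 2 * n) (hdJ : d ∉ J)
    {g : Vn F n ≃ₗ[F] Vn F n} (hg : g ∈ Par F n J) :
    ∃ c : F, c ≠ 0 ∧ ∀ v, sB F n (eb F n (d - 1)) (g v) = c * sB F n (eb F n (d - 1)) v := by
  obtain ⟨c, hc⟩ := apply_eb_pred hd h hdJ (inv_mem hg)
  have key : ∀ v, sB F n (eb F n (d - 1)) (g v) = c * sB F n (eb F n (d - 1)) v := fun v => by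
    rw [Par_sB_inv hg, hc, sB_smul_left]
  refine ⟨c, ?_, key⟩
  rintro rfl
  have := key (g⁻¹ (eb F n d))
  rw [zero_mul] at this
  have e : g (g⁻¹ (eb F n d)) = eb F n d := g.apply_symm_apply _
  rw [e, sB_eb_pred hd h] at this
  exact one_ne_zero this

/-- The image of `eb F n d` under `g`, scaled to have product `1` with `eb F n (d - 1)`. -/
def scaledPt (F : Type) [Field F] (n d : ℕ) (g : Vn F n ≃ₗ[F] Vn F n) : Vn F n :=
  (sB F n (eb F n (d - 1)) (g (eb F n d)))⁻¹ • g (eb F n d)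

theorem scaledPt_one (hd : Odd d) (h : d < 2 * n) : scaledPt F n d 1 = eb F n d := by
  simp [scaledPt, sB_eb_pred hd h]

theorem exists_scaledPt_mul (hd : Odd d) (h : d < 2 * n) (hdJ : d ∉ J) {g : Vn F n ≃ₗ[F] Vn F n}
    (hg : g ∈ Par F n J) : ∃ c : F, c ≠ 0 ∧ ∀ x, scaledPt F n d (g * x) = c • g (scaledPt F n d x) := by
  obtain ⟨c, hc, e⟩ := exists_sB_eb_pred_apply hd h hdJ hg
  refine ⟨c⁻¹, inv_ne_zero hc, fun x => ?_⟩
  rw [scaledPt, scaledPt, LinearEquiv.mul_apply, e, mul_inv, map_smul, smul_smul]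

theorem exists_apply_eq_smul_scaledPt (hd : Odd d) (h : d < 2 * n) (hdJ : d ∉ J)
    {g : Vn F n ≃ₗ[F] Vn F n} (hg : g ∈ Par F n J) :
    ∃ c : F, c ≠ 0 ∧ g (eb F n d) = c • scaledPt F n d g := by
  obtain ⟨c, hc, e⟩ := exists_sB_eb_pred_apply hd h hdJ hg
  have e' := e (eb F n d)
  rw [sB_eb_pred hd h, mul_one] at e'
  exact ⟨c, hc, by rw [scaledPt, e', smul_smul, mul_inv_cancel₀ hc, one_smul]⟩

theorem sB_scaledPt (hd : Odd d) (h : d < 2 * n) (hdJ : d ∉ J) {g : Vn F n ≃ₗ[F] Vn F n}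
    (hg : g ∈ Par F n J) : sB F n (eb F n (d - 1)) (scaledPt F n d g) = 1 := by
  obtain ⟨c, hc, e⟩ := exists_sB_eb_pred_apply hd h hdJ hg
  have e' := e (eb F n d)
  rw [sB_eb_pred hd h, mul_one] at e'
  rw [scaledPt, sB_smul_right, e', inv_mul_cancel₀ hc]

theorem scaledPt_sub_mem (hd : Odd d) (h : d < 2 * n) (hdJ : d ∉ J) (hd1 : d - 1 ∉ J) {m' : ℕ}
    (hm : d < m') {g : Vn F n ≃ₗ[F] Vn F n} (hg : g ∈ Par F n J)
    (hgm : g (eb F n d) ∈ Cl F n m') : scaledPt F n d g - eb F n d ∈ Wsub F n d m' := by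
  have h1 : eb F n d ∈ Wsub F n (d - 1) (2 * n) := by
    obtain ⟨k, rfl⟩ := hd
    exact eb_mem_Wsub_of_odd (by simp) (by omega) h h
  have h2 : g (eb F n d) ∈ Wsub F n (d - 1) m' :=
    ⟨hgm, fun c hc => by
      rw [Par_sB_inv hg]
      exact h1.2 _ (Par_apply_Cl (inv_mem hg) hd1 hc)⟩
  have h3 : scaledPt F n d g - eb F n d ∈ Wsub F n (d - 1 + 1) m' :=
    mem_Wsub_succ.mpr ⟨sub_mem (Submodule.smul_mem _ _ h2) ⟨eb_mem_Cl hm, h1.2⟩, by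
      rw [sB_sub_right, sB_scaledPt hd h hdJ hg, sB_eb_pred hd h, sub_self]⟩
  rwa [Nat.sub_add_cancel hd.pos] at h3

theorem exists_TW_scaledPt (hd : Odd d) {m' : ℕ} (h : d < 2 * n) (hm : d ≤ m') {v : Vn F n}
    (hv : v ∈ Wsub F n d m') : ∃ t ∈ TW F n d m', ∃ c : F,
      t (eb F n d) = eb F n d + v + c • eb F n (d - 1) ∧
      scaledPt F n d t = eb F n d + v + c • eb F n (d - 1) := by
  obtain ⟨t, ht, e⟩ := exists_TW_of_ne (d := d) (m := m') (x := eb F n d)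
    (y := eb F n d + v + (sB F n (eb F n d) v - 1) • eb F n (d - 1))
    (by
      rw [add_assoc, sub_add_cancel_left]
      exact neg_mem (add_mem hv (Submodule.smul_mem _ _ (eb_pred_mem_Wsub hd h hm))))
    (by simp [sB_eb_pred' hd h])
  exact ⟨t, ht, _, e, by simp [scaledPt, e, sB_eb_pred hd h, sB_eb_pred_of_mem hd hv]⟩

/-- Subtracting a multiple of `eb F n (d - 1)` makes a vector of `Wsub F n d m` orthogonal to
`eb F n d`. -/
theorem add_smul_mem_Wsub_succ (hd : Odd d) {m' : ℕ} (h : d < 2 * n) (hm : d ≤ m') {v : Vn F n}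
    (hv : v ∈ Wsub F n d m') :
    v + sB F n (eb F n d) v • eb F n (d - 1) ∈ Wsub F n (d + 1) m' :=
  mem_Wsub_succ.mpr ⟨add_mem hv (Submodule.smul_mem _ _ (eb_pred_mem_Wsub hd h hm)), by
    simp [sB_eb_pred' hd h]⟩

theorem inv_mul_mem_Par_erase_of_odd (hd : Odd d) (h : d < 2 * n) (hdJ : d ∉ J)
    {x y : Vn F n ≃ₗ[F] Vn F n} (hx : x ∈ Par F n J) (hy : y ∈ Par F n J) (c : F)
    (hxy : scaledPt F n d y = x (eb F n d) + c • eb F n (d - 1)) :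
    x⁻¹ * y ∈ Par F n (J.erase (d + 1)) := by
  obtain ⟨s, -, e⟩ := exists_apply_eq_smul_scaledPt hd h hdJ hy
  refine inv_mul_mem_Par_erase hdJ hx hy (c := s • (eb F n d + c • x⁻¹ (eb F n (d - 1))))
    (Submodule.smul_mem _ _ (add_mem (eb_mem_Cl d.lt_succ_self) (Submodule.smul_mem _ _
      (Cl_mono d.le_succ (Par_apply_Cl (inv_mem hx) hdJ (eb_pred_mem_Cl hd)))))) ?_
  have e' : x (x⁻¹ (eb F n (d - 1))) = eb F n (d - 1) := x.apply_symm_apply _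
  rw [e, hxy, map_smul, map_add, map_smul, e']

/-- The points represented by `x` and `y` are distinct modulo the radical of `Wsub F n d m`. -/
def Separated (F : Type) [Field F] (n d m : ℕ) (x y : Vn F n ≃ₗ[F] Vn F n) : Prop :=
  ∃ k ∈ Wsub F n d m, sB F n k (scaledPt F n d x) ≠ sB F n k (scaledPt F n d y)

theorem Separated.symm {x y : Vn F n ≃ₗ[F] Vn F n} (h : Separated F n d m x y) :
    Separated F n d m y x := by
  obtain ⟨k, hk, h⟩ := h
  exact ⟨k, hk, h.symm⟩

namespace IsBlock

variable (b : IsBlock n J d m)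
include b

theorem lt_two_mul : d < 2 * n := b.lt.trans_le b.le

theorem separated_smul (hd : Odd d) {g x y : Vn F n ≃ₗ[F] Vn F n} (hg : g ∈ Par F n J)
    (h : Separated F n d m x y) : Separated F n d m (g * x) (g * y) := by
  obtain ⟨k, hk, h⟩ := h
  obtain ⟨c, hc, e⟩ := exists_scaledPt_mul hd b.lt_two_mul b.left_notMem hg
  refine ⟨g k, Par_apply_Wsub hg b.left_notMem b.right_notMem hk, ?_⟩
  rw [e, e, sB_smul_right, sB_smul_right, Par_sB hg, Par_sB hg]
  exact fun h' => h (mul_left_cancel₀ hc h')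

theorem scaledPt_sub_mem (hd : Odd d) (hd1 : d - 1 ∉ J) {g : Vn F n ≃ₗ[F] Vn F n}
    (hg : g ∈ Par F n J) : scaledPt F n d g - eb F n d ∈ Wsub F n d m :=
  _root_.scaledPt_sub_mem hd b.lt_two_mul b.left_notMem hd1 b.lt hg
    (Par_apply_Cl hg b.right_notMem (eb_mem_Cl b.lt))

theorem scaledPt_of_mem (hd : Odd d) (hd1 : d - 1 ∉ J) {p : Vn F n ≃ₗ[F] Vn F n}
    (hp : p ∈ Par F n (J.erase (d + 1))) :
    ∃ c : F, scaledPt F n d p = eb F n d + c • eb F n (d - 1) := by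
  have hn := b.lt_two_mul
  obtain ⟨hpG, hp'⟩ := (mem_Par_erase_succ b.left_notMem).mp hp
  have h1 := _root_.scaledPt_sub_mem hd hn b.left_notMem hd1 d.lt_succ_self hpG hp'
  obtain ⟨c, hc⟩ := exists_of_mem_Cl_succ h1.1
  have hc0 : c = 0 := by
    have h2 := (eb_pred_mem_Wsub (F := F) (m := d) hd hn le_rfl).2 _ hc
    rw [sB_swap, sB_sub_right, sB_eb_pred_of_mem hd h1, sB_smul_right, sB_eb_pred hd hn] at h2
    simpa using h2
  rw [hc0, zero_smul, sub_zero] at hc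
  obtain ⟨k, hk⟩ := hd
  have h2 : scaledPt F n d p - eb F n d ∈ Cl F n (2 * k + 1) := by rwa [← hk]
  obtain ⟨r, hr⟩ := eq_smul_of_mem_Wsub (by simp) (Wsub_mono (by omega) le_rfl h1) h2
  exact ⟨r, by rw [show d - 1 = 2 * k by omega, ← hr]; abel⟩

theorem separated_right (hd : Odd d) (hd1 : d - 1 ∉ J) {x y p : Vn F n ≃ₗ[F] Vn F n}
    (hy : y ∈ Par F n J) (hp : p ∈ Par F n (J.erase (d + 1))) (h : Separated F n d m x y) :
    Separated F n d m x (y * p) := by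
  obtain ⟨k, hk, h⟩ := h
  refine ⟨k, hk, ?_⟩
  obtain ⟨c, hc⟩ := b.scaledPt_of_mem hd hd1 hp
  obtain ⟨r, -, hr⟩ := exists_scaledPt_mul hd b.lt_two_mul b.left_notMem hy
  obtain ⟨s, hs⟩ := apply_eb_pred hd b.lt_two_mul b.left_notMem hy
  have e1 := hr 1
  rw [mul_one, scaledPt_one hd b.lt_two_mul] at e1
  rw [hr, hc, map_add, smul_add, ← e1, map_smul, hs]
  simpa [sB_of_mem_eb_pred hd hk] using h

/-- A point distinct from the base point lies on a translate of the standard line. -/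
theorem exists_translate (hd : Odd d) (hd1 : d - 1 ∉ J) {m' : ℕ} (h3 : d + 3 ≤ m') (hle : m' ≤ m)
    {g : Vn F n ≃ₗ[F] Vn F n} (hg : g ∈ Par F n J) (hgm : g (eb F n d) ∈ Cl F n m') {k : Vn F n}
    (hk : k ∈ Wsub F n (d + 1) m')
    (h : sB F n k (scaledPt F n d g) ≠ 0) :
    ∃ h ∈ TW F n (d + 1) m', ∃ c : F,
      scaledPt F n d g = eb F n d + h (eb F n (d + 1)) + c • eb F n (d - 1) := by
  have hn := b.lt_two_mul
  have hm := b.le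
  have hd2 : Even (d + 1) := by simpa [parity_simps] using hd
  have hD := _root_.scaledPt_sub_mem hd hn b.left_notMem hd1 (by omega) hg hgm
  have hD' := add_smul_mem_Wsub_succ hd hn (by omega) hD
  have hk' := mem_Wsub_succ.mp hk
  have hke : sB F n k (eb F n d) = 0 := by rw [sB_swap, hk'.2, neg_zero]
  obtain ⟨r, hr, er⟩ := exists_TW_of_mem
    (eb_mem_Wsub_of_even (F := F) (d := d + 1) (m := m') hd2 (by omega) (by omega) (by omega)) hD'
    (eb_mem_Wsub_of_odd (F := F) (d := d + 1) (m := m') hd2 le_rfl (by omega) (by omega)) hk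
    (by rw [sB_eb_pair' hd2 (by omega)]; simp)
    (by simpa [sB_of_mem_eb_pred hd hk'.1, hke] using h)
  exact ⟨r, hr, -sB F n (eb F n d) (scaledPt F n d g - eb F n d), by rw [er]; module⟩

theorem edge_of_odd (hd : Odd d) (hd1 : d - 1 ∉ J) {m' : ℕ} (h3 : d + 3 ≤ m') (hle : m' ≤ m)
    {g : Vn F n ≃ₗ[F] Vn F n} (hg : g ∈ Par F n J) (hgm : g (eb F n d) ∈ Cl F n m') {k : Vn F n}
    (hk : k ∈ Wsub F n (d + 1) m')
    (h : sB F n k (scaledPt F n d g) ≠ 0) :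
    ∃ h ∈ TW F n (d + 1) m', ∃ t ∈ TW F n d (d + 2),
      (h * t)⁻¹ * g ∈ Par F n (J.erase (d + 1)) := by
  have hn := b.lt_two_mul
  have hm := b.le
  have hd2 : Even (d + 1) := by simpa [parity_simps] using hd
  obtain ⟨r, hr, c, e⟩ := b.exists_translate hd hd1 h3 hle hg hgm hk h
  obtain ⟨t, ht, s, e', -⟩ := exists_TW_scaledPt (m' := d + 2) hd hn (by omega)
    (eb_mem_Wsub_of_even (F := F) (d := d) hd2 (by omega) (by omega) (by omega))
  refine ⟨r, hr, t, ht, inv_mul_mem_Par_erase_of_odd hd hn b.left_notMem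
    (mul_mem (b.TW_le d.le_succ hle hr) (b.TW_le le_rfl (by omega) ht)) hg (c - s) ?_⟩
  have h1 : r (eb F n d) = eb F n d := TW_apply_Cl hr (eb_mem_Cl d.lt_succ_self)
  have h2 : r (eb F n (d - 1)) = eb F n (d - 1) :=
    TW_apply_Cl hr (Cl_mono d.le_succ (eb_pred_mem_Cl hd))
  rw [LinearEquiv.mul_apply, e', e]
  simp only [map_add, map_smul, h1, h2]
  module

theorem exists_witness (hd : Odd d) {g : Vn F n ≃ₗ[F] Vn F n} (hg : g ∈ Par F n J)
    (h : Separated F n d m 1 g) : ∃ k ∈ Wsub F n (d + 1) m, sB F n k (scaledPt F n d g) ≠ 0 := by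
  have hn := b.lt_two_mul
  obtain ⟨k, hk, h⟩ := h
  refine ⟨_, add_smul_mem_Wsub_succ hd hn b.lt.le hk, fun h0 => h ?_⟩
  rw [scaledPt_one hd hn, sB_swap]
  rw [sB_add_left, sB_smul_left, sB_scaledPt hd hn b.left_notMem hg] at h0
  linear_combination -h0

theorem exists_witness_plane (hd : Odd d) (hd1 : d - 1 ∉ J) (h3 : d + 3 ≤ m)
    {g : Vn F n ≃ₗ[F] Vn F n} (hg : g ∈ Par F n J) (hgm : g (eb F n d) ∈ Cl F n (d + 3))
    {k : Vn F n} (hk : k ∈ Wsub F n (d + 1) m) (h : sB F n k (scaledPt F n d g) ≠ 0) :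
    ∃ l ∈ Wsub F n (d + 1) (d + 3), sB F n l (scaledPt F n d g) ≠ 0 := by
  have hn := b.lt_two_mul
  have hm := b.le
  have hd2 : Even (d + 1) := by simpa [parity_simps] using hd
  have hD := _root_.scaledPt_sub_mem hd hn b.left_notMem hd1 (by omega) hg hgm
  have hD' := add_smul_mem_Wsub_succ hd hn (by omega) hD
  have key : ∀ {r}, ∀ l ∈ Wsub F n (d + 1) r, sB F n l (scaledPt F n d g) =
      sB F n l (scaledPt F n d g - eb F n d +
        sB F n (eb F n d) (scaledPt F n d g - eb F n d) • eb F n (d - 1)) := fun l hl => by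
    have hl' := mem_Wsub_succ.mp hl
    have hle : sB F n l (eb F n d) = 0 := by rw [sB_swap, hl'.2, neg_zero]
    simp [sB_of_mem_eb_pred hd hl'.1, hle]
  by_contra! h0
  have h1 := h0 _ (eb_mem_Wsub_of_even (F := F) (d := d + 1) (m := d + 3) hd2 (by omega) (by omega)
    (by omega))
  have h2 := h0 _ (eb_mem_Wsub_of_odd (F := F) (d := d + 1) (m := d + 3) hd2 le_rfl (by omega)
    (by omega))
  rw [key (r := d + 3) _ (eb_mem_Wsub_of_even hd2 (by omega) (by omega) (by omega)),
    sB_eb_even hd2 (by omega)] at h1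
  rw [key (r := d + 3) _ (eb_mem_Wsub_of_odd hd2 le_rfl (by omega) (by omega)),
    sB_eb_odd hd2 (by omega), neg_eq_zero] at h2
  rw [key k hk] at h
  refine h ?_
  convert sB_zero_right k using 2
  funext i
  rcases lt_or_ge (i : ℕ) (d + 1) with hi | hi
  · exact apply_eq_zero_of_mem_Wsub hd2 hD' hi
  rcases hi.eq_or_lt with hi | hi
  · have e : i = ⟨d + 1, by omega⟩ := Fin.ext hi.symm
    rw [e]
    exact h2
  rcases (Nat.succ_le_of_lt hi).eq_or_lt with hi | hi
  · have e : i = ⟨d + 1 + 1, by omega⟩ := Fin.ext hi.symm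
    rw [e]
    exact h1
  · exact mem_Cl.mp hD'.1 i hi

theorem edge_of_odd_of_separated (hd : Odd d) (hd1 : d - 1 ∉ J) (h3 : d + 3 ≤ m)
    {g : Vn F n ≃ₗ[F] Vn F n} (hg : g ∈ Par F n J) (h : Separated F n d m 1 g) :
    ∃ h ∈ Par F n (J.erase (d + 1)), ∃ t ∈ Par F n (J.erase (d + 2)),
      (h * t)⁻¹ * g ∈ Par F n (J.erase (d + 1)) := by
  obtain ⟨l, hl, hlg⟩ := b.exists_witness hd hg h
  obtain ⟨k, hk, t, ht, hp⟩ := b.edge_of_odd hd hd1 h3 le_rfl hg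
    (Par_apply_Cl hg b.right_notMem (eb_mem_Cl b.lt)) hl hlg
  exact ⟨k, b.TW_le_erase (by omega) le_rfl (by omega) hk,
    t, b.TW_le_erase le_rfl (by omega) (by omega) ht, hp⟩

theorem exists_scaledPt_eq (hd : Odd d) {v : Vn F n} (hv : v ∈ Wsub F n d m) :
    ∃ w ∈ Par F n J, ∃ c : F, scaledPt F n d w = eb F n d + v + c • eb F n (d - 1) := by
  obtain ⟨t, ht, c, -, e⟩ := exists_TW_scaledPt hd b.lt_two_mul b.lt.le hv
  exact ⟨t, b.TW_le le_rfl le_rfl ht, c, e⟩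

theorem dichotomy_of_odd (hd : Odd d) (h3 : d + 3 ≤ m) {t : Vn F n ≃ₗ[F] Vn F n}
    (ht : t ∈ Par F n (J.erase (d + 2))) :
    t ∈ Par F n (J.erase (d + 1)) ∨ Separated F n d m 1 t := by
  have hle := b.le
  have hn := b.lt_two_mul
  have hd2 : Even (d + 1) := by simpa [parity_simps] using hd
  rw [Par_erase] at ht
  refine or_iff_not_imp_right.mpr fun h => (mem_Par_erase_succ b.left_notMem).mpr ⟨ht.1, ?_⟩
  obtain ⟨c, -, e⟩ := exists_apply_eq_smul_scaledPt hd hn b.left_notMem ht.1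
  simp only [Separated, not_exists, not_and, not_not] at h
  have h := h _ (eb_mem_Wsub_of_odd hd2 (by omega) (by omega) (by omega))
  rw [scaledPt_one hd hn, sB_eb_odd hd2 (by omega), sB_eb_odd hd2 (by omega)] at h
  have h1 := ht.2 _ (eb_mem_Cl (show d < d + 2 by omega))
  refine mem_Cl.mpr fun i hi => ?_
  rcases hi.eq_or_lt with hi | hi
  · have e1 : i = ⟨d + 1, by omega⟩ := Fin.ext hi.symm
    rw [e, e1, Pi.smul_apply, ← neg_inj.mp h]
    simp [eb]
  · exact mem_Cl.mp h1 i hi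

theorem diameter_of_odd (hF : 2 < Cardinal.mk F) (hd : Odd d) (hd1 : d - 1 ∉ J) (h3 : d + 3 ≤ m)
    {g : Vn F n ≃ₗ[F] Vn F n} (hg : g ∈ Par F n J) :
    ∃ w ∈ Par F n J, Separated F n d m 1 w ∧ Separated F n d m w g := by
  have hle := b.le
  have hn := b.lt_two_mul
  have hd2 : Even (d + 1) := by simpa [parity_simps] using hd
  by_cases h : Separated F n d m 1 g
  · obtain ⟨k, hk, h⟩ := h
    rw [scaledPt_one hd hn] at h
    obtain ⟨α, h0, h1⟩ := exists_ne_and_ne hF 0 1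
    obtain ⟨w, hw, c, e⟩ := b.exists_scaledPt_eq hd
      (Submodule.smul_mem _ α (b.scaledPt_sub_mem hd hd1 hg))
    have hkw : sB F n k (scaledPt F n d w) = sB F n k (eb F n d) +
        α * (sB F n k (scaledPt F n d g) - sB F n k (eb F n d)) := by
      simp [e, sB_of_mem_eb_pred hd hk]
    have hne := sub_ne_zero.mpr h.symm
    refine ⟨w, hw, ⟨k, hk, ?_⟩, k, hk, ?_⟩
    · rw [scaledPt_one hd hn, hkw]
      simpa [h0] using hne
    · rw [hkw]
      intro h'
      refine mul_ne_zero (sub_ne_zero.mpr h1) hne ?_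
      linear_combination h'
  · simp only [Separated, not_exists, not_and, not_not] at h
    have hk := eb_mem_Wsub_of_odd (F := F) (n := n) (d := d) (m := m) hd2 (by omega) (by omega) (by omega)
    obtain ⟨w, hw, c, e⟩ := b.exists_scaledPt_eq hd
      (eb_mem_Wsub_of_even (F := F) (n := n) (d := d) (m := m) hd2 (by omega) (by omega) (by omega))
    have hkw : sB F n (eb F n (d + 1 + 1)) (scaledPt F n d w) =
        sB F n (eb F n (d + 1 + 1)) (scaledPt F n d 1) - 1 := by
      simp [e, sB_of_mem_eb_pred hd hk, scaledPt_one hd hn,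
        sB_eb_pair' hd2 (show d + 1 + 1 < 2 * n by omega), sub_eq_add_neg]
    refine ⟨w, hw, ⟨_, hk, ?_⟩, _, hk, ?_⟩
    · rw [hkw]
      exact fun h' => one_ne_zero (α := F) (by linear_combination h')
    · rw [hkw, h _ hk]; simp

theorem path_of_odd (hF : 2 < Cardinal.mk F) (hd : Odd d) (hd1 : d - 1 ∉ J)
    {z x y : Vn F n ≃ₗ[F] Vn F n} (hz : z ∈ Par F n J) (h1 : Separated F n d m 1 z) :
    Separated F n d m 1 x ∨ Separated F n d m z y ∨ ∃ w ∈ Par F n J,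
      Separated F n d m 1 w ∧ Separated F n d m z w ∧ Separated F n d m x w ∧
        Separated F n d m y w := by
  by_cases h4 : Separated F n d m 1 x
  · exact Or.inl h4
  by_cases h5 : Separated F n d m z y
  · exact Or.inr (Or.inl h5)
  refine Or.inr (Or.inr ?_)
  have hn := b.lt_two_mul
  simp only [Separated, not_exists, not_and, not_not] at h4 h5
  obtain ⟨k, hk, h⟩ := h1
  rw [scaledPt_one hd hn] at h
  obtain ⟨α, h0, h1⟩ := exists_ne_and_ne hF 0 1
  obtain ⟨w, hw, c, e⟩ := b.exists_scaledPt_eq hd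
    (Submodule.smul_mem _ α (b.scaledPt_sub_mem hd hd1 hz))
  have hkw : sB F n k (scaledPt F n d w) = sB F n k (eb F n d) +
      α * (sB F n k (scaledPt F n d z) - sB F n k (eb F n d)) := by
    simp [e, sB_of_mem_eb_pred hd hk]
  have hne := sub_ne_zero.mpr h.symm
  have h1w : sB F n k (scaledPt F n d 1) ≠ sB F n k (scaledPt F n d w) := by
    rw [scaledPt_one hd hn, hkw]
    simpa [h0] using hne
  have hzw : sB F n k (scaledPt F n d z) ≠ sB F n k (scaledPt F n d w) := by
    rw [hkw]
    intro h'
    refine mul_ne_zero (sub_ne_zero.mpr h1) hne ?_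
    linear_combination -h'
  exact ⟨w, hw, ⟨k, hk, h1w⟩, ⟨k, hk, hzw⟩, ⟨k, hk, by rwa [← h4 k hk]⟩,
    ⟨k, hk, by rwa [← h5 k hk]⟩⟩

theorem coplanar_one_of_odd (hd : Odd d) (hd1 : d - 1 ∉ J) (h4 : d + 4 ≤ m)
    {y z : Vn F n ≃ₗ[F] Vn F n} (hy : y ∈ Par F n J) (hz : z ∈ Par F n J)
    (h : sB F n (scaledPt F n d y - eb F n d) (scaledPt F n d z - eb F n d) ≠ 0) :
    IsCoplanarTriple (Par F n J) (Par F n (J.erase (d + 1))) (Par F n (J.erase (d + 3))) 1 y z := by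
  have hle := b.le
  have hn := b.lt_two_mul
  have hd2 : Even (d + 1) := by simpa [parity_simps] using hd
  have hvW := b.scaledPt_sub_mem hd hd1 hy
  have hwW := b.scaledPt_sub_mem hd hd1 hz
  obtain ⟨v, ev⟩ : ∃ v, v = scaledPt F n d y - eb F n d := ⟨_, rfl⟩
  obtain ⟨w, ew⟩ : ∃ w, w = scaledPt F n d z - eb F n d := ⟨_, rfl⟩
  rw [← ev] at hvW h
  rw [← ew] at hwW h
  have hv := add_smul_mem_Wsub_succ hd hn b.lt.le hvW
  have hw := add_smul_mem_Wsub_succ hd hn b.lt.le hwW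
  have hs : sB F n (v + sB F n (eb F n d) v • eb F n (d - 1))
      (w + sB F n (eb F n d) w • eb F n (d - 1)) = sB F n v w := by
    simp [sB_of_mem_eb_pred hd hvW, sB_eb_pred_of_mem hd hwW]
  have hfW := eb_mem_Wsub_of_even (F := F) (n := n) (d := d + 1) (m := m) hd2 (by omega) (by omega)
    (by omega)
  have hfW' := eb_mem_Wsub_of_odd (F := F) (n := n) (d := d + 1) (m := m) hd2 le_rfl (by omega) (by omega)
  obtain ⟨p, hp, ep⟩ := exists_TW_of_mem hfW hv hfW' hw (by rw [sB_eb_pair' hd2 (by omega)]; simp)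
    (by rw [sB_swap, hs]; simpa using h)
  have hpG := b.TW_le d.le_succ le_rfl hp
  obtain ⟨l, el⟩ : ∃ l, l = p⁻¹ (w + sB F n (eb F n d) w • eb F n (d - 1)) := ⟨_, rfl⟩
  have epl : p l = w + sB F n (eb F n d) w • eb F n (d - 1) := by
    rw [el]; exact p.apply_symm_apply _
  have hlW : l ∈ Wsub F n (d + 1) m := by
    rw [el]; exact TW_apply_Wsub (inv_mem hp) hw
  have hfl : sB F n (eb F n (d + 1)) l = sB F n v w := by
    rw [← Par_sB hpG, ep, epl, hs]
  obtain ⟨q, hq, eq⟩ := exists_TW_of_partner (d := d + 2) (m := m) (e := eb F n (d + 1))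
    (x := sB F n v w • eb F n (d + 2)) (y := l)
    (eb_mem_Wsub_of_even hd2 (by omega) (by omega) (by omega))
    (mem_Wsub_succ.mpr ⟨sub_mem (Submodule.smul_mem _ _ hfW') hlW, by
      simp [hfl, sB_eb_pair hd2 (show d + 1 + 1 < 2 * n by omega)]⟩)
    (by simpa [sB_eb_pair hd2 (show d + 1 + 1 < 2 * n by omega)] using h)
    (by simp [hfl, sB_eb_pair hd2 (show d + 1 + 1 < 2 * n by omega)])
  have hqG := b.TW_le (show d ≤ d + 2 by omega) le_rfl hq
  have hgG := mul_mem hpG hqG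
  obtain ⟨u, hu, c, eu, -⟩ := exists_TW_scaledPt (m' := d + 3) hd hn (by omega)
    (eb_mem_Wsub_of_even (F := F) (n := n) (d := d) hd2 (by omega) (by omega) (by omega))
  obtain ⟨u', hu', c', eu', -⟩ := exists_TW_scaledPt (m' := d + 3) hd hn (by omega)
    (Submodule.smul_mem _ (sB F n v w)
      (eb_mem_Wsub_of_odd (F := F) (n := n) (d := d) hd2 (by omega) (by omega) (by omega)))
  have hqe : q (eb F n d) = eb F n d := TW_apply_Cl hq (eb_mem_Cl (by omega))
  have hpe : p (eb F n d) = eb F n d := TW_apply_Cl hp (eb_mem_Cl (by omega))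
  have hqe0 : q (eb F n (d - 1)) = eb F n (d - 1) := TW_apply_Cl hq (eb_mem_Cl (by omega))
  have hpe0 : p (eb F n (d - 1)) = eb F n (d - 1) := TW_apply_Cl hp (eb_mem_Cl (by omega))
  have hqf : q (eb F n (d + 1)) = eb F n (d + 1) := TW_apply_Cl hq (eb_mem_Cl (by omega))
  have hle3 := b.TW_le_erase (F := F) (d' := d) (m' := d + 3) (j := d + 3) le_rfl (by omega)
    (Or.inr le_rfl)
  have hleG := b.TW_le (F := F) (d' := d) (m' := d + 3) le_rfl (by omega)
  refine ⟨p * q, hgG, 1, one_mem _, u, hle3 hu, u', hle3 hu', ?_, ?_, ?_⟩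
  · refine inv_mul_mem_Par_erase_of_odd hd hn b.left_notMem (mul_mem hgG (one_mem _)) (one_mem _)
      0 ?_
    simp [hqe, hpe, scaledPt_one hd hn]
  · refine inv_mul_mem_Par_erase_of_odd hd hn b.left_notMem (mul_mem hgG (hleG hu)) hy
      (-c - sB F n (eb F n d) v) ?_
    rw [LinearEquiv.mul_apply, LinearEquiv.mul_apply, eu, eq_add_of_sub_eq' ev.symm]
    simp only [map_add, map_smul, hqe, hpe, hqe0, hpe0, hqf, ep]
    module
  · refine inv_mul_mem_Par_erase_of_odd hd hn b.left_notMem (mul_mem hgG (hleG hu')) hz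
      (-c' - sB F n (eb F n d) w) ?_
    rw [LinearEquiv.mul_apply, LinearEquiv.mul_apply, eu', eq_add_of_sub_eq' ew.symm,
      map_add q, map_add q, eq]
    simp only [map_add, map_smul, hqe, hpe, hqe0, hpe0, epl]
    module

theorem coplanar_of_odd (hd : Odd d) (hd1 : d - 1 ∉ J) (h4 : d + 4 ≤ m)
    {x y z : Vn F n ≃ₗ[F] Vn F n} (hx : x ∈ Par F n J) (hy : y ∈ Par F n J) (hz : z ∈ Par F n J)
    (h : sB F n (scaledPt F n d y - scaledPt F n d x) (scaledPt F n d z - scaledPt F n d x) ≠ 0) :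
    IsCoplanarTriple (Par F n J) (Par F n (J.erase (d + 1))) (Par F n (J.erase (d + 3))) x y z := by
  have hxi := inv_mem hx
  obtain ⟨c, hc, e⟩ := exists_scaledPt_mul hd b.lt_two_mul b.left_notMem hxi
  have ex := e x
  rw [inv_mul_cancel, scaledPt_one hd b.lt_two_mul] at ex
  have := (b.coplanar_one_of_odd hd hd1 h4 (mul_mem hxi hy) (mul_mem hxi hz) (by
    rw [e, e, ex, ← smul_sub, ← smul_sub, ← map_sub, ← map_sub, sB_smul_left, sB_smul_right,
      Par_sB hxi]
    exact mul_ne_zero hc (mul_ne_zero hc h))).smul hx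
  simpa using this

theorem triangle_of_odd (hF : 2 < Cardinal.mk F) (hd : Odd d) (hd1 : d - 1 ∉ J) (h4 : d + 4 ≤ m)
    {y z : Vn F n ≃ₗ[F] Vn F n} (hy : y ∈ Par F n J) (hz : z ∈ Par F n J)
    (h1y : Separated F n d m 1 y) (h1z : Separated F n d m 1 z) (hyz : Separated F n d m y z) :
    IsCoplanarTriple (Par F n J) (Par F n (J.erase (d + 1))) (Par F n (J.erase (d + 3))) 1 y z ∨
    ∃ w ∈ Par F n J, Separated F n d m 1 w ∧
      IsCoplanarTriple (Par F n J) (Par F n (J.erase (d + 1))) (Par F n (J.erase (d + 3))) 1 y w ∧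
      IsCoplanarTriple (Par F n J) (Par F n (J.erase (d + 1))) (Par F n (J.erase (d + 3))) 1 z w ∧
      IsCoplanarTriple (Par F n J) (Par F n (J.erase (d + 1))) (Par F n (J.erase (d + 3))) y z w ∧
      Separated F n d m y w ∧ Separated F n d m z w := by
  have hn := b.lt_two_mul
  have hvW := b.scaledPt_sub_mem hd hd1 hy
  have hwW := b.scaledPt_sub_mem hd hd1 hz
  have e1 := scaledPt_one (F := F) hd hn
  obtain ⟨v, ev⟩ : ∃ v, v = scaledPt F n d y - eb F n d := ⟨_, rfl⟩
  obtain ⟨w, ew⟩ : ∃ w, w = scaledPt F n d z - eb F n d := ⟨_, rfl⟩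
  have ey := eq_add_of_sub_eq' ev.symm
  have ez := eq_add_of_sub_eq' ew.symm
  rw [← ev] at hvW
  rw [← ew] at hwW
  by_cases h : sB F n v w = 0
  swap
  · exact Or.inl (b.coplanar_of_odd hd hd1 h4 (one_mem _) hy hz (by rwa [e1, ← ev, ← ew]))
  obtain ⟨k₁, hk₁, h₁⟩ := h1y
  obtain ⟨k₂, hk₂, h₂⟩ := h1z
  obtain ⟨k₃, hk₃, h₃⟩ := hyz
  have h₁ : sB F n k₁ v ≠ 0 := by simpa [e1, ey] using h₁
  have h₂ : sB F n k₂ w ≠ 0 := by simpa [e1, ez] using h₂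
  have h₃ : sB F n k₃ v ≠ sB F n k₃ w := by simpa [ey, ez] using h₃
  obtain ⟨u, hu, huv, huw, hvw⟩ : ∃ u ∈ Wsub F n d m, sB F n u v ≠ 0 ∧ sB F n u w ≠ 0 ∧
      sB F n u v ≠ sB F n u w := by
    obtain ⟨u, hu, huv, huw⟩ := exists_ne_ne hk₁ hk₂ h₁ h₂
    by_cases hvw : sB F n u v = sB F n u w
    · obtain ⟨c, hc1, hc2⟩ := exists_add_mul_ne hF (p := sB F n k₃ v) (r := sB F n k₃ w)
        (Or.inr huv) (Or.inr huw)
      refine ⟨k₃ + c • u, add_mem hk₃ (Submodule.smul_mem _ _ hu), by simpa using hc1,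
        by simpa using hc2, ?_⟩
      simpa [hvw] using h₃
    · exact ⟨u, hu, huv, huw, hvw⟩
  obtain ⟨g, hg, c, eg⟩ := b.exists_scaledPt_eq hd hu
  have hvu : sB F n v u ≠ 0 := by rw [sB_swap]; simpa using huv
  have hwu : sB F n w u ≠ 0 := by rw [sB_swap]; simpa using huw
  have hve := sB_of_mem_eb_pred hd hvW
  have hwe := sB_of_mem_eb_pred hd hwW
  refine Or.inr ⟨g, hg, ⟨v, hvW, ?_⟩, b.coplanar_of_odd hd hd1 h4 (one_mem _) hy hg ?_,
    b.coplanar_of_odd hd hd1 h4 (one_mem _) hz hg ?_, b.coplanar_of_odd hd hd1 h4 hy hz hg ?_,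
    ⟨v, hvW, ?_⟩, w, hwW, ?_⟩
  · simpa [e1, eg, hve] using hvu
  · simpa [e1, eg, ey, hve, add_assoc] using hvu
  · simpa [e1, eg, ez, hwe, add_assoc] using hwu
  · have e : sB F n (scaledPt F n d z - scaledPt F n d y) (scaledPt F n d g - scaledPt F n d y) =
        sB F n u v - sB F n u w := by
      have hzy : scaledPt F n d z - scaledPt F n d y = w - v := by rw [ey, ez]; abel
      have hgy : scaledPt F n d g - scaledPt F n d y = u + c • eb F n (d - 1) - v := by
        rw [ey, eg]; abel
      rw [hzy, hgy, sB_swap v u, sB_swap w u]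
      simp only [sB_add_right, sB_sub_right, sB_sub_left, sB_smul_right, hve, hwe, sB_self,
        sB_swap v w, h]
      ring
    rw [e]
    exact sub_ne_zero.mpr hvw
  · simpa [eg, ey, hve] using hvu
  · simpa [eg, ez, hwe] using hwu

theorem triangleGeometry_of_odd (hF : 2 < Cardinal.mk F) (hd : Odd d) (hd1 : d - 1 ∉ J)
    (h4 : d + 4 ≤ m) :
    TriangleGeometry (Par F n J) (Par F n (J.erase (d + 1))) (Par F n (J.erase (d + 2)))
      (Par F n (J.erase (d + 3))) (Separated F n d m) where
  le₁ := Par_mono F n (Finset.erase_subset _ _)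
  le₂ := Par_mono F n (Finset.erase_subset _ _)
  le₃ := Par_mono F n (Finset.erase_subset _ _)
  smul hg _ _ h := b.separated_smul hd hg h
  symm h := h.symm
  right _ hy hp h := b.separated_right hd hd1 hy hp h
  irrefl {p} hp := by
    rintro ⟨k, hk, h⟩
    obtain ⟨c, hc⟩ := b.scaledPt_of_mem hd hd1 hp
    simp [hc, scaledPt_one hd b.lt_two_mul, sB_of_mem_eb_pred hd hk] at h
  dichotomy ht := b.dichotomy_of_odd hd (by omega) ht
  edge hg h := b.edge_of_odd_of_separated hd hd1 (by omega) hg h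
  line_unique := b.line_unique
  plane {u} hu h := by
    rw [Par_erase] at hu
    have hm := hu.2 _ (eb_mem_Cl (show d < d + 3 by omega))
    obtain ⟨l, hl, hlu⟩ := b.exists_witness hd hu.1 h
    obtain ⟨r, hr, hru⟩ := b.exists_witness_plane hd hd1 (by omega) hu.1 hm hl hlu
    obtain ⟨k, hk, t, ht, hp⟩ := b.edge_of_odd hd hd1 le_rfl (by omega) hu.1 hm hr hru
    exact ⟨k, ⟨b.TW_le_erase (by omega) (by omega) (by omega) hk,
      b.TW_le_erase (by omega) (by omega) (by omega) hk⟩,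
      t, ⟨b.TW_le_erase le_rfl (by omega) (by omega) ht,
      b.TW_le_erase le_rfl (by omega) (by omega) ht⟩, hp⟩
  triangle := b.triangle_of_odd hF hd hd1 h4
  diameter := b.diameter_of_odd hF hd hd1 (by omega)
  path hz _ _ h _ _ := b.path_of_odd hF hd hd1 hz h

theorem le_sup_of_odd (hF : 2 < Cardinal.mk F) (hd : Odd d) (hd1 : d - 1 ∉ J) (h3 : d + 3 ≤ m) :
    Par F n J ≤ Par F n (J.erase (d + 1)) ⊔ Par F n (J.erase (d + 2)) :=
  le_sup_of_diameter (A := Separated F n d m) (fun hg _ _ h => b.separated_smul hd hg h)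
    (b.edge_of_odd_of_separated hd hd1 h3) (b.diameter_of_odd hF hd hd1 h3)

end IsBlock

end Odd

section Gap

variable {F : Type} [Field F] {n : ℕ} {J : Finset ℕ} {d m : ℕ}

theorem sB_eq_zero_of_mem_Cl {k : ℕ} (hk : Even k) {c v : Vn F n} (hc : c ∈ Cl F n k)
    (hv : ∀ i : Fin (2 * n), i < k → v i = 0) : sB F n c v = 0 := by
  rw [Nat.even_iff] at hk
  induction hc using Submodule.span_induction with
  | mem x hx =>
    obtain ⟨i, hi, rfl⟩ := hx
    have e : (Pi.single i 1 : Vn F n) = eb F n i := by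
      funext j; simp [eb, Pi.single_apply, Fin.ext_iff]
    rw [e]
    have hi2 := i.2
    rcases Nat.even_or_odd' i with ⟨l, h | h⟩
    · rw [h, sB_eb_even (by simp) (by omega)]
      exact hv _ (show 2 * l + 1 < k by omega)
    · rw [h, sB_eb_odd (by simp) (by omega), hv _ (show 2 * l < k by omega), neg_zero]
  | zero => exact sB_zero_left _
  | add x y _ _ hx hy => rw [sB_add_left, hx, hy, add_zero]
  | smul a x _ hx => rw [sB_smul_left, hx, mul_zero]

namespace IsBlock

variable (b : IsBlock n J d m)
include b

theorem exists_TW_inv_mul_mem_of_odd (hd : Odd d) {g : Vn F n ≃ₗ[F] Vn F n}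
    (hg : g ∈ Par F n J) : ∃ t ∈ TW F n d m, t⁻¹ * g ∈ Par F n (J.erase (d + 1)) := by
  have hn : d < 2 * n := b.lt.trans_le b.le
  have hdJ := b.left_notMem
  obtain ⟨c, -, hc⟩ := exists_apply_eq_smul_scaledPt hd hn hdJ hg
  have hs := sB_scaledPt hd hn hdJ hg
  have hm : scaledPt F n d g ∈ Cl F n m :=
    Submodule.smul_mem _ _ (Par_apply_Cl hg b.right_notMem (eb_mem_Cl b.lt))
  set D := scaledPt F n d g - eb F n d with hD
  have hDm : D ∈ Cl F n m := sub_mem hm (eb_mem_Cl b.lt)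
  have hDs : sB F n (eb F n (d - 1)) D = 0 := by
    rw [hD, sB_sub_right, hs, sB_eb_pred hd hn, sub_self]
  let D' : Vn F n := fun i => if (i : ℕ) < d - 1 then D i else 0
  have hD' : D' ∈ Cl F n (d - 1) := mem_Cl.mpr fun i hi => if_neg (by omega)
  have hpos := hd.pos
  have hlt := b.lt
  have hk : Even (d - 1) := hd.tsub_odd odd_one
  have hw : D - D' ∈ Wsub F n d m := by
    refine ⟨sub_mem hDm (Cl_mono (by omega) hD'), fun x hx => ?_⟩
    rw [← Nat.sub_add_cancel hpos] at hx
    obtain ⟨r, hr⟩ := exists_of_mem_Cl_succ hx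
    have h1 : sB F n (x - r • eb F n (d - 1)) (D - D') = 0 :=
      sB_eq_zero_of_mem_Cl hk hr fun i hi => by simp [D', hi]
    have h2 : sB F n (eb F n (d - 1)) D' = 0 := by
      have := sB_eq_zero_of_mem_Cl hk hD' (v := eb F n (d - 1)) fun i hi => by
        simp [eb, hi.ne]
      rw [sB_swap, this, neg_zero]
    rw [sB_sub_left, sB_smul_left, sB_sub_right (eb F n (d - 1)), hDs, h2] at h1
    simpa using h1
  obtain ⟨t, ht, γ, e, -⟩ := exists_TW_scaledPt hd hn b.lt.le hw
  have htf {x : Vn F n} (hx : x ∈ Cl F n d) : t x = x := TW_apply_Cl ht hx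
  have h0 := eb_pred_mem_Cl (F := F) (n := n) hd
  have h1 := Cl_mono (Nat.sub_le d 1) hD'
  refine ⟨t, ht, inv_mul_mem_Par_erase hdJ (b.TW_le le_rfl le_rfl ht) hg
    (c := c • (eb F n d + (D' - γ • eb F n (d - 1)))) ?_ ?_⟩
  · exact Submodule.smul_mem _ _ (add_mem (eb_mem_Cl d.lt_succ_self)
      (Cl_mono d.le_succ (sub_mem h1 (Submodule.smul_mem _ _ h0))))
  · rw [hc, map_smul, map_add, map_sub, map_smul, htf h0, htf h1, e, hD]
    module

theorem exists_TW_inv_mul_mem_of_even (hd : Even d) (h2 : d + 2 ≤ m) {g : Vn F n ≃ₗ[F] Vn F n}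
    (hg : g ∈ Par F n J) : ∃ t ∈ TW F n d m, t⁻¹ * g ∈ Par F n (J.erase (d + 1)) := by
  have hle := b.le
  have hdJ := b.left_notMem
  have hf : eb F n (d + 1) ∈ Wsub F n d m :=
    eb_mem_Wsub_of_odd hd le_rfl (by omega) (by omega)
  have hs := sB_eb_pair' (F := F) hd (show d + 1 < 2 * n by omega)
  obtain ⟨t, ht, e⟩ := exists_TW_of_mem (b.eb_mem_Wsub hd) (b.apply_eb_mem_Wsub hd hg) hf
    (Par_apply_Wsub hg hdJ b.right_notMem hf) (by rw [hs]; simp) (by rw [Par_sB hg, hs]; simp)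
  exact ⟨t, ht, inv_mul_mem_Par_erase_of_smul hdJ (b.TW_le le_rfl le_rfl ht) hg 1
    (by rw [e, one_smul])⟩

/-- The transvections supported on a block are transitive on the points moved by that block. -/
theorem exists_TW_inv_mul_mem (h2 : d + 2 ≤ m) {g : Vn F n ≃ₗ[F] Vn F n}
    (hg : g ∈ Par F n J) : ∃ t ∈ TW F n d m, t⁻¹ * g ∈ Par F n (J.erase (d + 1)) :=
  d.even_or_odd.elim (fun h => b.exists_TW_inv_mul_mem_of_even h h2 hg)
    fun h => b.exists_TW_inv_mul_mem_of_odd h hg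

/-- Erasing indices outside of a block keeps its transvections. -/
theorem exists_mem_inf_inv_mul_mem (h2 : d + 2 ≤ m) {i j : ℕ} (hi : i ≤ d ∨ m ≤ i)
    (hj : j ≤ d ∨ m ≤ j) {g : Vn F n ≃ₗ[F] Vn F n} (hg : g ∈ Par F n J) :
    ∃ t ∈ Par F n (J.erase i) ⊓ Par F n (J.erase j), t⁻¹ * g ∈ Par F n (J.erase (d + 1)) := by
  obtain ⟨t, ht, h⟩ := b.exists_TW_inv_mul_mem h2 hg
  exact ⟨t, ⟨b.TW_le_erase le_rfl le_rfl hi ht, b.TW_le_erase le_rfl le_rfl hj ht⟩, h⟩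

end IsBlock

end Gap

section Generation

variable {F : Type} [Field F] {n : ℕ} {J : Finset ℕ}

theorem IsBlock.exists_of_notMem (hJ : J ⊆ Finset.Icc 1 (2 * n - 1)) {d : ℕ} (hd : d ∉ J)
    (hn : d < 2 * n) : ∃ m, IsBlock n J d m := by
  classical
  have h2 : d < 2 * n ∧ 2 * n ∉ J := ⟨hn, fun h => by
    have := Finset.mem_Icc.mp (hJ h); omega⟩
  have hex : ∃ m, d < m ∧ m ∉ J := ⟨_, h2⟩
  refine ⟨Nat.find hex, hd, (Nat.find_spec hex).2, (Nat.find_spec hex).1, Nat.find_min' hex h2,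
    fun l h1 hl => ?_⟩
  by_contra h
  exact Nat.find_min hex hl ⟨h1, h⟩

theorem exists_succ_mem_forall_le_notMem (hJ : J ⊆ Finset.Icc 1 (2 * n - 1)) (h : J.Nonempty) :
    ∃ d, d + 1 ∈ J ∧ d < 2 * n ∧ ∀ l ≤ d, l ∉ J := by
  have h1 := Finset.mem_Icc.mp (hJ (J.min'_mem h))
  refine ⟨J.min' h - 1, ?_, by omega, fun l hl hlJ => ?_⟩
  · rw [Nat.sub_add_cancel h1.1]
    exact J.min'_mem h
  · have := J.min'_le l hlJ
    omega

/-- The first block of `J`. -/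
theorem IsBlock.exists_first (hJ : J ⊆ Finset.Icc 1 (2 * n - 1)) (h : J.Nonempty) :
    ∃ d m, IsBlock n J d m ∧ d + 2 ≤ m ∧ ∀ l ≤ d, l ∉ J := by
  obtain ⟨d, hd, hn, hl⟩ := exists_succ_mem_forall_le_notMem hJ h
  obtain ⟨m, b⟩ := IsBlock.exists_of_notMem hJ (hl d le_rfl) hn
  refine ⟨d, m, b, ?_, hl⟩
  have := b.lt
  have : m ≠ d + 1 := by rintro rfl; exact b.right_notMem hd
  omega

theorem exists_Par_le_sup (hF : 2 < Cardinal.mk F) (hJ : J ⊆ Finset.Icc 1 (2 * n - 1))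
    (hc : 2 ≤ J.card) :
    ∃ i ∈ J, ∃ j ∈ J, Par F n J ≤ Par F n (J.erase i) ⊔ Par F n (J.erase j) := by
  obtain ⟨d, m, b, h2, hl⟩ := IsBlock.exists_first hJ (Finset.card_pos.mp (by omega))
  have hd1 : d + 1 ∈ J := b.mem _ (by omega) (by omega)
  by_cases h3 : d + 3 ≤ m
  · refine ⟨d + 1, hd1, d + 2, b.mem _ (by omega) (by omega), ?_⟩
    rcases d.even_or_odd with h | h
    · exact b.le_sup_of_even h h2
    · exact b.le_sup_of_odd hF h (hl _ (by omega)) h3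
  · obtain ⟨j, hj, hne⟩ := Finset.exists_mem_ne hc (d + 1)
    refine ⟨d + 1, hd1, j, hj, fun g hg => ?_⟩
    have hjm : m ≤ j := by
      by_contra! h
      exact hl j (by omega) hj
    obtain ⟨t, ht, h⟩ := b.exists_mem_inf_inv_mul_mem h2 (.inr hjm) (.inr hjm) hg
    rw [← mul_inv_cancel_left t g]
    exact mul_mem (Subgroup.mem_sup_right ht.1) (Subgroup.mem_sup_left h)

/-- A parabolic is generated by any two of its maximal standard subparabolics. -/
theorem Par_le_sup (hF : 2 < Cardinal.mk F) (hJ : J ⊆ Finset.Icc 1 (2 * n - 1)) {i j : ℕ}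
    (hi : i ∈ J) (hj : j ∈ J) (hij : i ≠ j) :
    Par F n J ≤ Par F n (J.erase i) ⊔ Par F n (J.erase j) := by
  induction J using Finset.strongInduction with
  | H J ih =>
    have key : ∀ k ∈ J, Par F n (J.erase k) ≤ Par F n (J.erase i) ⊔ Par F n (J.erase j) := by
      intro k hk
      by_cases hki : k = i
      · exact hki ▸ le_sup_left
      by_cases hkj : k = j
      · exact hkj ▸ le_sup_right
      refine (ih _ (Finset.erase_ssubset hk) ((Finset.erase_subset _ _).trans hJ)
        (Finset.mem_erase.mpr ⟨Ne.symm hki, hi⟩) (Finset.mem_erase.mpr ⟨Ne.symm hkj, hj⟩)).trans ?_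
      exact sup_le_sup (Par_mono F n (Finset.erase_subset_erase _ (Finset.erase_subset _ _)))
        (Par_mono F n (Finset.erase_subset_erase _ (Finset.erase_subset _ _)))
    obtain ⟨a, ha, c, hc, h⟩ := exists_Par_le_sup hF hJ (Finset.one_lt_card.mpr ⟨i, hi, j, hj, hij⟩)
    exact h.trans (sup_le (key a ha) (key c hc))

end Generation

section Completion

variable {F : Type} [Field F] {n : ℕ} {J : Finset ℕ} {H : Type*} [Group H]

/-- A lift of the amalgam of maximal standard subparabolics of `P_J`. -/
structure ParLift (n : ℕ) (J : Finset ℕ) (π : H →* (Vn F n ≃ₗ[F] Vn F n)) (Γ : J → Subgroup H) :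
    Prop where
  map : ∀ k : J, (Γ k).map π = Par F n (J.erase k)
  inj : ∀ k, ∀ x ∈ Γ k, ∀ k', ∀ y ∈ Γ k', π x = π y → x = y

namespace ParLift

variable {π : H →* (Vn F n ≃ₗ[F] Vn F n)} {Γ : J → Subgroup H} (l : ParLift n J π Γ)
include l

theorem amalgamLift (i j k : J) : AmalgamLift π (Γ i) (Γ j) (Γ k) (Par F n (J.erase i))
    (Par F n (J.erase j)) (Par F n (J.erase k)) where
  map₁ := l.map i
  map₂ := l.map j
  map₃ := l.map k
  inj := by
    rintro x ((hx | hx) | hx) y ((hy | hy) | hy) h <;> exact l.inj _ x hx _ y hy h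

theorem inf_le_map (i k : J) :
    Par F n ((J.erase k).erase i) ≤ (Γ k ⊓ Γ i).map π := by
  intro g hg
  have h1 : g ∈ (Γ k).map π := by
    rw [l.map]; exact Par_mono F n (Finset.erase_subset _ _) hg
  have h2 : g ∈ (Γ i).map π := by
    rw [l.map]; exact Par_mono F n (Finset.erase_subset_erase _ (Finset.erase_subset _ _)) hg
  obtain ⟨x, hx, rfl⟩ := h1
  obtain ⟨y, hy, e⟩ := h2
  obtain rfl := l.inj _ x hx _ y hy e.symm
  exact ⟨x, ⟨hx, hy⟩, rfl⟩

theorem iSup_le_sup (hF : 2 < Cardinal.mk F) (hJ : J ⊆ Finset.Icc 1 (2 * n - 1)) {i j : J}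
    (hij : i ≠ j) : ⨆ k, Γ k ≤ Γ i ⊔ Γ j := by
  refine iSup_le fun k => ?_
  by_cases hki : k = i
  · exact hki ▸ le_sup_left
  by_cases hkj : k = j
  · exact hkj ▸ le_sup_right
  intro x hx
  have h1 : π x ∈ Par F n (J.erase k) := l.map k ▸ Subgroup.mem_map_of_mem π hx
  have h2 := (Par_le_sup hF ((Finset.erase_subset _ _).trans hJ)
    (Finset.mem_erase.mpr ⟨fun h => hki (Subtype.ext h.symm), i.2⟩)
    (Finset.mem_erase.mpr ⟨fun h => hkj (Subtype.ext h.symm), j.2⟩)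
    fun h => hij (Subtype.ext h)).trans (sup_le_sup (l.inf_le_map i k) (l.inf_le_map j k)) h1
  rw [← Subgroup.map_sup] at h2
  obtain ⟨y, hy, e⟩ := h2
  obtain rfl := l.inj k y ((sup_le inf_le_left inf_le_left : Γ k ⊓ Γ i ⊔ Γ k ⊓ Γ j ≤ Γ k) hy) k x hx e
  exact (sup_le_sup inf_le_right inf_le_right : Γ k ⊓ Γ i ⊔ Γ k ⊓ Γ j ≤ Γ i ⊔ Γ j) hy

theorem eq_one_of_isBlock (hF : 2 < Cardinal.mk F) (hJ : J ⊆ Finset.Icc 1 (2 * n - 1)) {d m : ℕ}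
    (b : IsBlock n J d m) (h2 : d + 2 ≤ m) {i j : J} (hij : i ≠ j) (hi : (i : ℕ) ≤ d ∨ m ≤ i)
    (hj : (j : ℕ) ≤ d ∨ m ≤ j) {x : H} (hx : x ∈ ⨆ k, Γ k) (h1 : π x = 1) : x = 1 :=
  (l.amalgamLift ⟨d + 1, b.mem _ (by omega) (by omega)⟩ i j).eq_one_of_transitive
    (fun _ hg => b.exists_mem_inf_inv_mul_mem h2 hi hj
      (sup_le (Par_mono F n (Finset.erase_subset _ _)) (Par_mono F n (Finset.erase_subset _ _)) hg))
    (l.iSup_le_sup hF hJ hij hx) h1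

theorem eq_one_of_map_eq_one (hF : 2 < Cardinal.mk F) (hJ : J ⊆ Finset.Icc 1 (2 * n - 1))
    (hc : 3 ≤ J.card) {x : H} (hx : x ∈ ⨆ k, Γ k) (h1 : π x = 1) : x = 1 := by
  obtain ⟨d, m, b, h2, hl⟩ := IsBlock.exists_first hJ (Finset.card_pos.mp (by omega))
  by_cases hR : 1 < (J.filter (m ≤ ·)).card
  · obtain ⟨i, hi, j, hj, hij⟩ := Finset.one_lt_card.mp hR
    rw [Finset.mem_filter] at hi hj
    exact l.eq_one_of_isBlock hF hJ b h2 (i := ⟨i, hi.1⟩) (j := ⟨j, hj.1⟩)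
      (fun h => hij (congrArg Subtype.val h)) (.inr hi.2) (.inr hj.2) hx h1
  have hJm : J = Finset.Ioo d m ∪ J.filter (m ≤ ·) := by
    ext a
    simp only [Finset.mem_union, Finset.mem_Ioo, Finset.mem_filter]
    constructor
    · intro ha
      have : d < a := by
        by_contra! h
        exact hl a h ha
      rcases lt_or_ge a m with h | h
      · exact .inl ⟨this, h⟩
      · exact .inr ⟨ha, h⟩
    · rintro (h | h)
      · exact b.mem a h.1 h.2
      · exact h.1
  have hcard := (congrArg Finset.card hJm).trans_le (Finset.card_union_le _ _)
  rw [Nat.card_Ioo] at hcard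
  by_cases hR0 : (J.filter (m ≤ ·)).Nonempty
  · obtain ⟨k, hk⟩ := hR0
    have hk1 : ∀ a ∈ J, m ≤ a → a = k := fun a ha h =>
      Finset.card_le_one.mp (not_lt.mp hR) a (Finset.mem_filter.mpr ⟨ha, h⟩) k hk
    rw [Finset.mem_filter] at hk
    have hkm : k ≠ m := by rintro rfl; exact b.right_notMem hk.1
    have hb : IsBlock n J (k - 1) (k + 1) :=
      { left_notMem := fun h => by
          by_cases h' : k - 1 = m
          · exact b.right_notMem (h' ▸ h)
          · have := hk1 _ h (by omega)
            omega
        right_notMem := fun h => by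
          have := hk1 _ h (by omega)
          omega
        lt := by omega
        le := by
          have := Finset.mem_Icc.mp (hJ hk.1)
          omega
        mem := fun a h h' => by
          obtain rfl : a = k := by omega
          exact hk.1 }
    exact l.eq_one_of_isBlock hF hJ hb (by omega)
      (i := ⟨d + 1, b.mem _ (by omega) (by omega)⟩) (j := ⟨d + 2, b.mem _ (by omega) (by omega)⟩)
      (by simp) (.inl (by simp only; omega)) (.inl (by simp only; omega)) hx h1
  · rw [Finset.not_nonempty_iff_eq_empty] at hR0
    rw [hR0, Finset.card_empty] at hcard
    have hA := l.amalgamLift ⟨d + 1, b.mem _ (by omega) (by omega)⟩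
      ⟨d + 2, b.mem _ (by omega) (by omega)⟩ ⟨d + 3, b.mem _ (by omega) (by omega)⟩
    have hx' := l.iSup_le_sup hF hJ (i := ⟨d + 1, b.mem _ (by omega) (by omega)⟩)
      (j := ⟨d + 2, b.mem _ (by omega) (by omega)⟩) (by simp) hx
    rcases d.even_or_odd with h | h
    · exact (b.triangleGeometry_of_even hF h (by omega)).eq_one_of_map_eq_one hA hx' h1
    · exact (b.triangleGeometry_of_odd hF h (hl _ (by omega)) (by omega)).eq_one_of_map_eq_one
        hA hx' h1

theorem map_iSup (hF : 2 < Cardinal.mk F) (hJ : J ⊆ Finset.Icc 1 (2 * n - 1))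
    (hc : 2 ≤ J.card) : (⨆ k, Γ k).map π = Par F n J := by
  simp only [Subgroup.map_iSup, l.map]
  refine le_antisymm (iSup_le fun k => Par_mono F n (Finset.erase_subset _ _)) ?_
  obtain ⟨i, hi, j, hj, hij⟩ := Finset.one_lt_card.mp hc
  exact (Par_le_sup hF hJ hi hj hij).trans
    (sup_le (le_iSup (fun k : J => Par F n (J.erase k)) ⟨i, hi⟩)
      (le_iSup (fun k : J => Par F n (J.erase k)) ⟨j, hj⟩))

end ParLift

/-- A subgroup of a product that projects isomorphically to the first factor is a graph. -/
theorem exists_hom_of_graph {L K : Type*} [Group L] [Group K] {G : Subgroup L}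
    {Δ : Subgroup (L × K)} (hmap : Δ.map (MonoidHom.fst L K) = G)
    (hinj : ∀ x ∈ Δ, x.1 = 1 → x = 1) :
    ∃ Φ : G →* K, ∀ (g : G) (k : K), ((g : L), k) ∈ Δ → Φ g = k := by
  have hfst : ∀ x : Δ, (x : L × K).1 ∈ G := fun x =>
    hmap ▸ Subgroup.mem_map_of_mem (MonoidHom.fst L K) x.2
  let p : Δ →* G := ((MonoidHom.fst L K).comp Δ.subtype).codRestrict G hfst
  have hp : Function.Bijective p := by
    refine ⟨(injective_iff_map_eq_one p).mpr fun x hx => Subtype.ext (hinj _ x.2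
      (congrArg Subtype.val hx)), fun g => ?_⟩
    obtain ⟨x, hx, e⟩ := hmap.ge g.2
    exact ⟨⟨x, hx⟩, Subtype.ext e⟩
  let e := MulEquiv.ofBijective p hp
  refine ⟨((MonoidHom.snd L K).comp Δ.subtype).comp e.symm.toMonoidHom, fun g k h => ?_⟩
  have : e.symm g = ⟨(g, k), h⟩ := e.symm_apply_eq.mpr (Subtype.ext rfl)
  simp [this]

theorem closure_iUnion_Par_erase (hF : 2 < Cardinal.mk F) (hJ : J ⊆ Finset.Icc 1 (2 * n - 1))
    (hc : 2 ≤ J.card) :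
    Subgroup.closure (⋃ j ∈ J, (Par F n (J.erase j) : Set (Vn F n ≃ₗ[F] Vn F n))) = Par F n J := by
  refine le_antisymm ?_ ?_
  · rw [Subgroup.closure_le]
    exact Set.iUnion₂_subset fun j _ => Par_mono F n (Finset.erase_subset _ _)
  · obtain ⟨i, hi, j, hj, hij⟩ := Finset.one_lt_card.mp hc
    have h : ∀ k ∈ J, Par F n (J.erase k) ≤
        Subgroup.closure (⋃ j ∈ J, (Par F n (J.erase j) : Set (Vn F n ≃ₗ[F] Vn F n))) :=
      fun k hk _ hg => Subgroup.subset_closure (Set.mem_iUnion₂.mpr ⟨k, hk, hg⟩)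
    exact (Par_le_sup hF hJ hi hj hij).trans (sup_le (h i hi) (h j hj))

theorem hom_ext_of_Par_erase (hF : 2 < Cardinal.mk F) (hJ : J ⊆ Finset.Icc 1 (2 * n - 1))
    (hc : 2 ≤ J.card) {K : Type*} [Group K] {Φ Ψ : Par F n J →* K}
    (h : ∀ j ∈ J, ∀ g : Par F n (J.erase j),
      Φ (Subgroup.inclusion (Par_mono F n (Finset.erase_subset j J)) g) =
        Ψ (Subgroup.inclusion (Par_mono F n (Finset.erase_subset j J)) g)) : Φ = Ψ := by
  obtain ⟨i, hi, j, hj, hij⟩ := Finset.one_lt_card.mp hc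
  have key : ∀ k ∈ J, Par F n (J.erase k) ≤ (Φ.eqLocus Ψ).map (Par F n J).subtype :=
    fun k hk g hg => ⟨_, h k hk ⟨g, hg⟩, rfl⟩
  ext g
  obtain ⟨g', hg', e⟩ := (Par_le_sup hF hJ hi hj hij).trans (sup_le (key i hi) (key j hj)) g.2
  obtain rfl : g' = g := Subtype.ext e
  exact hg'

theorem parLift_graph {K : Type} [Group K] (f : (j : ℕ) → j ∈ J → Par F n (J.erase j) →* K)
    (hf : ∀ (j : ℕ) (hj : j ∈ J) (j' : ℕ) (hj' : j' ∈ J)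
      (g : ↥(Par F n (J.erase j) ⊓ Par F n (J.erase j'))),
      f j hj (Subgroup.inclusion inf_le_left g) = f j' hj' (Subgroup.inclusion inf_le_right g)) :
    ParLift n J (MonoidHom.fst (Vn F n ≃ₗ[F] Vn F n) K)
      (fun k => ((Par F n (J.erase k)).subtype.prod (f k k.2)).range) where
  map k := by
    rw [MonoidHom.map_range, MonoidHom.fst_comp_prod, Subgroup.range_subtype]
  inj := by
    rintro k _ ⟨g, rfl⟩ k' _ ⟨g', rfl⟩ h
    replace h : (g : Vn F n ≃ₗ[F] Vn F n) = g' := h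
    exact Prod.ext h ((hf k k.2 k' k'.2 ⟨g, g.2, h ▸ g'.2⟩).trans
      (congrArg (f k' k'.2) (Subtype.ext h)))

end Completion

/-- **For `|F| ≥ 3` and `J ⊆ I` with `|J| ≥ 3`, the parabolic `P_J` of `Sp_{2n}(F)` is the
universal completion of the amalgam `{P_{J−{j}} : j ∈ J}`.** -/
theorem parabolic_universal_completion (F : Type) [Field F] (n : ℕ) (hn : 2 ≤ n)
    (hF : 2 < Cardinal.mk F) (J : Finset ℕ) (hJI : J ⊆ Finset.Icc 1 (2*n-1))
    (hJcard : 3 ≤ J.card) :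
    (Subgroup.closure (⋃ j ∈ J,
        ((Par F n (J.erase j) : Subgroup ((Vn F n) ≃ₗ[F] (Vn F n))) :
          Set ((Vn F n) ≃ₗ[F] (Vn F n)))) = Par F n J) ∧
    (∀ (K : Type) [Group K]
      (f : (j : ℕ) → j ∈ J → ↥(Par F n (J.erase j)) →* K),
      (∀ (j : ℕ) (hj : j ∈ J) (j' : ℕ) (hj' : j' ∈ J)
        (g : ↥(Par F n (J.erase j) ⊓ Par F n (J.erase j'))),
        f j hj (Subgroup.inclusion inf_le_left g) = f j' hj' (Subgroup.inclusion inf_le_right g)) →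
      ∃! Φ : ↥(Par F n J) →* K,
        ∀ (j : ℕ) (hj : j ∈ J) (g : ↥(Par F n (J.erase j))),
          Φ (Subgroup.inclusion (Par_mono F n (Finset.erase_subset j J)) g) = f j hj g) := by
  have hc : 2 ≤ J.card := (Nat.le_succ 2).trans hJcard
  refine ⟨closure_iUnion_Par_erase hF hJI hc, fun K _ f hf => ?_⟩
  have l := parLift_graph f hf
  obtain ⟨Φ, hΦ⟩ := exists_hom_of_graph (l.map_iSup hF hJI hc)
    (fun x hx h => l.eq_one_of_map_eq_one hF hJI hJcard hx h)
  have h : ∀ (j : ℕ) (hj : j ∈ J) (g : ↥(Par F n (J.erase j))),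
      Φ (Subgroup.inclusion (Par_mono F n (Finset.erase_subset j J)) g) = f j hj g := by
    intro j hj g
    apply hΦ
    exact Subgroup.mem_iSup_of_mem (ι := J) ⟨j, hj⟩ (MonoidHom.mem_range.mpr ⟨g, rfl⟩)
  refine ⟨Φ, h, fun Ψ hΨ => hom_ext_of_Par_erase hF hJI hc fun j hj g => ?_⟩
  exact (hΨ j hj g).trans (h j hj g).symm
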